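/- arXiv:2405.06369 — 5 statements merged into one kernel-verified Lean document; each statement's English description precedes it below -/
import Mathlib

section
/- Let (A,m) → (B,n) → (C,p) be local homomorphisms of Noetherian local rings such that B and C are flat over A, and such that B ⊗_A k(m) is a field. Then C is flat over B. -/
open TensorProduct in
/-- Pushout-type exactness after tensoring. -/
lemma FlatAux.pushout {B C K P Q M : Type*} [CommRing B] [AddCommGroup C] [Module B C]
    [AddCommGroup K] [Module B K] [AddCommGroup P] [Module B P]
    [AddCommGroup Q] [Module B Q] [AddCommGroup M] [Module B M]
    (f : K →ₗ[B] P) (g : K →ₗ[B] Q) (i : P →ₗ[B] M) (j : Q →ₗ[B] M)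
    (hsurj : Function.Surjective (i.coprod j))
    (hex : Function.Exact (f.prod g) (i.coprod j))
    (y : C ⊗[B] P) (hy : i.lTensor C y = 0) :
    ∃ z : C ⊗[B] K, f.lTensor C z = y ∧ g.lTensor C z = 0 := by
  have h := lTensor_exact C hex hsurj
  have h1 : (i.coprod j).lTensor C ((LinearMap.inl B P Q).lTensor C y) = 0 := by
    rw [← LinearMap.comp_apply, ← LinearMap.lTensor_comp, LinearMap.coprod_inl, hy]
  obtain ⟨z, hz⟩ := (h _).1 h1
  refine ⟨z, ?_, ?_⟩
  · have := congrArg ((LinearMap.fst B P Q).lTensor C) hz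
    simp only [← LinearMap.comp_apply, ← LinearMap.lTensor_comp, LinearMap.fst_prod,
      LinearMap.fst_comp_inl, LinearMap.lTensor_id] at this
    simpa using this
  · have := congrArg ((LinearMap.snd B P Q).lTensor C) hz
    simp only [← LinearMap.comp_apply, ← LinearMap.lTensor_comp, LinearMap.snd_prod,
      LinearMap.snd_comp_inl] at this
    simpa using this

open TensorProduct in
lemma FlatAux.step {B C : Type*} [CommRing B] [AddCommGroup C] [Module B C]
    (n : Ideal B) [hn : n.IsMaximal]
    (hinj : Function.Injective (n.subtype.lTensor C)) (I J : Ideal B) (hIJ : I ≤ J) (x : B)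
    (hxI : x ∉ I) (hxn : ∀ a ∈ n, a * x ∈ I) (hJ : J = I ⊔ Ideal.span {x}) :
    Function.Injective ((Submodule.inclusion hIJ).lTensor C) := by
  have hxJ : x ∈ J := by
    rw [hJ]; exact Ideal.mem_sup_right (Ideal.mem_span_singleton_self x)
  have hxn' : ∀ a, a * x ∈ I → a ∈ n := by
    intro a ha
    by_contra hna
    obtain ⟨b, hb⟩ := hn.exists_inv hna
    obtain ⟨c, hc, hbc⟩ := hb
    apply hxI
    have : x = b * (a * x) + c * x := by linear_combination (-x) * hbc
    rw [this]
    exact I.add_mem (I.mul_mem_left _ ha) (hxn c hc)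
  let f : n →ₗ[B] I := ((LinearMap.toSpanSingleton B B x).comp n.subtype).codRestrict I
    (fun a => by simpa using hxn a a.2)
  let j : B →ₗ[B] J := LinearMap.toSpanSingleton B J ⟨x, hxJ⟩
  rw [injective_iff_map_eq_zero]
  intro y hy
  obtain ⟨z, hz1, hz2⟩ := FlatAux.pushout f (-n.subtype) (Submodule.inclusion hIJ) j
    (by
      rintro ⟨w, hw⟩
      have hw' := hw
      rw [hJ, Submodule.mem_sup] at hw'
      obtain ⟨p, hp, q, hq, rfl⟩ := hw'
      obtain ⟨b, rfl⟩ := Ideal.mem_span_singleton'.1 hq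
      exact ⟨(⟨p, hp⟩, b), by ext; simp [j]⟩)
    (by
      rintro ⟨⟨p, hp⟩, b⟩
      constructor
      · intro h
        have h' : p + b * x = 0 := by simpa [j] using congrArg Subtype.val h
        have hb : -b ∈ n := hxn' _ (by
          have : -b * x = p := by linear_combination -h'
          rwa [this])
        refine ⟨⟨-b, hb⟩, ?_⟩
        ext
        · simp [f]; linear_combination -h'
        · simp
      · rintro ⟨⟨a, ha⟩, h⟩
        have h1 : a * x = p := by simpa [f] using congrArg (fun t => (t.1 : B)) h
        have h2 : -a = b := by simpa using congrArg (fun t => t.2) h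
        ext
        simp [j, ← h1, ← h2]) y hy
  have : z = 0 := by
    apply hinj
    rw [LinearMap.lTensor_neg, LinearMap.neg_apply, neg_eq_zero] at hz2
    simpa using hz2
  rw [← hz1, this, map_zero]

open TensorProduct in
lemma FlatAux.cofinite {B C : Type*} [CommRing B] [IsNoetherianRing B] [AddCommGroup C] [Module B C]
    (n : Ideal B) [hn : n.IsMaximal]
    (hinj : Function.Injective (n.subtype.lTensor C)) (k : ℕ) (I : Ideal B) (hk : n ^ k ≤ I) :
    Function.Injective (I.subtype.lTensor C) := by
  induction I using WellFoundedGT.induction with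
  | ind I ih =>
    by_cases hI : I = ⊤
    · subst hI
      have : (Submodule.subtype (⊤ : Ideal B)) = (Submodule.topEquiv (R := B) (M := B)).toLinearMap :=
        rfl
      rw [this]
      exact (LinearEquiv.lTensor C (Submodule.topEquiv (R := B) (M := B))).injective
    · classical
      have hex : ∃ t, n ^ t ≤ I := ⟨k, hk⟩
      obtain ⟨t, ht, hmin⟩ : ∃ t, n ^ t ≤ I ∧ ∀ s < t, ¬ n ^ s ≤ I :=
        ⟨Nat.find hex, Nat.find_spec hex, fun s hs => Nat.find_min hex hs⟩
      cases t with
      | zero => exact absurd (by simpa using ht) hI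
      | succ t =>
        obtain ⟨x, hx, hxI⟩ := SetLike.not_le_iff_exists.1 (hmin t (Nat.lt_succ_self t))
        have hle : I ≤ I ⊔ Ideal.span {x} := le_sup_left
        have hlt : I < I ⊔ Ideal.span {x} := lt_of_le_of_ne hle (fun h => hxI (by
          rw [h]; exact Ideal.mem_sup_right (Ideal.mem_span_singleton_self x)))
        have h1 := ih _ hlt (hk.trans hle)
        have h2 := FlatAux.step (C := C) n hinj I _ hle x hxI
          (fun a ha => ht (by rw [pow_succ']; exact Ideal.mul_mem_mul ha hx)) rfl
        have : I.subtype = (Submodule.subtype (I ⊔ Ideal.span {x})).comp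
          (Submodule.inclusion hle) := rfl
        rw [this, LinearMap.lTensor_comp]
        exact h1.comp h2

open TensorProduct in
lemma FlatAux.deep {B C : Type*} [CommRing B] [CommRing C] [Algebra B C]
    (n J L : Ideal B) (s : ℕ) (hL : L ≤ J) (h : L ≤ n ^ s • J) (z : C ⊗[B] L) :
    (Submodule.inclusion hL).lTensor C z ∈
      ((n.map (algebraMap B C)) ^ s • ⊤ : Submodule C (C ⊗[B] J)) := by
  induction z with
  | zero => simp
  | add x y hx hy => rw [map_add]; exact Submodule.add_mem _ hx hy
  | tmul c l =>
    have key : ∀ w (hw : w ∈ n ^ s • J) (hwJ : w ∈ J), c ⊗ₜ[B] (⟨w, hwJ⟩ : J) ∈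
      ((n.map (algebraMap B C)) ^ s • ⊤ : Submodule C (C ⊗[B] J)) := by
      intro w hw
      induction hw using Submodule.smul_induction_on' with
      | smul r hr m hm =>
        intro hwJ
        have : c ⊗ₜ[B] (⟨r • m, hwJ⟩ : J) = algebraMap B C r • (c ⊗ₜ[B] (⟨m, hm⟩ : J)) := by
          rw [algebraMap_smul, ← TensorProduct.tmul_smul]; rfl
        rw [this]
        refine Submodule.smul_mem_smul ?_ trivial
        rw [← Ideal.map_pow]
        exact Ideal.mem_map_of_mem _ hr
      | add x hx y hy h1 h2 =>
        intro hwJ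
        have hx' : x ∈ J := Submodule.smul_le_right hx
        have hy' : y ∈ J := Submodule.smul_le_right hy
        have : c ⊗ₜ[B] (⟨x + y, hwJ⟩ : J) = c ⊗ₜ[B] (⟨x, hx'⟩ : J) + c ⊗ₜ[B] (⟨y, hy'⟩ : J) := by
          rw [← TensorProduct.tmul_add]; rfl
        rw [this]
        exact Submodule.add_mem _ (h1 hx') (h2 hy')
    exact key l (h l.2) (hL l.2)

open TensorProduct in
lemma FlatAux.local_criterion {B C : Type*} [CommRing B] [CommRing C] [Algebra B C]
    [IsNoetherianRing B] [IsNoetherianRing C] [IsLocalRing C]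
    (n : Ideal B) [hn : n.IsMaximal] (hnC : n.map (algebraMap B C) ≠ ⊤)
    (hinj : Function.Injective (n.subtype.lTensor C)) : Module.Flat B C := by
  rw [Module.Flat.iff_lTensor_injective']
  intro J
  rw [injective_iff_map_eq_zero]
  intro x hx
  have hbot := Ideal.iInf_pow_smul_eq_bot_of_isLocalRing (M := C ⊗[B] J) _ hnC
  suffices x ∈ (⨅ i : ℕ, (n.map (algebraMap B C)) ^ i • ⊤ : Submodule C (C ⊗[B] J)) by
    rw [hbot] at this; simpa using this
  rw [Submodule.mem_iInf]
  intro s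
  obtain ⟨k, hk⟩ := Ideal.exists_pow_inf_eq_pow_smul n (J : Submodule B B)
  have hAR : J ⊓ n ^ (s + k) ≤ n ^ s • J := by
    have := hk (s + k) (Nat.le_add_left _ _)
    rw [Nat.add_sub_cancel, smul_eq_mul, Ideal.mul_top] at this
    rw [inf_comm, this]
    exact Submodule.smul_mono le_rfl inf_le_right
  have hJ' := FlatAux.cofinite n hinj (s + k) (J ⊔ n ^ (s + k)) le_sup_right
  have hx' : (Submodule.inclusion (le_sup_left : J ≤ J ⊔ n ^ (s + k))).lTensor C x = 0 := by
    apply hJ'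
    rw [← LinearMap.comp_apply, ← LinearMap.lTensor_comp, map_zero]
    exact hx
  obtain ⟨z, hz, -⟩ := FlatAux.pushout
    (Submodule.inclusion (inf_le_left : J ⊓ n ^ (s + k) ≤ J))
    (-Submodule.inclusion (inf_le_right : J ⊓ n ^ (s + k) ≤ n ^ (s + k)))
    (Submodule.inclusion (le_sup_left : J ≤ J ⊔ n ^ (s + k)))
    (Submodule.inclusion (le_sup_right : n ^ (s + k) ≤ J ⊔ n ^ (s + k)))
    (by
      rintro ⟨w, hw⟩
      have hw' := hw
      rw [Submodule.mem_sup] at hw'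
      obtain ⟨p, hp, q, hq, rfl⟩ := hw'
      exact ⟨(⟨p, hp⟩, ⟨q, hq⟩), by ext; simp⟩)
    (by
      rintro ⟨⟨p, hp⟩, ⟨q, hq⟩⟩
      constructor
      · intro h
        have h' : p + q = 0 := by simpa using congrArg Subtype.val h
        have hpq : p = -q := eq_neg_of_add_eq_zero_left h'
        refine ⟨⟨p, hp, by rw [hpq]; exact neg_mem hq⟩, ?_⟩
        ext
        · simp
        · simp [hpq]
      · rintro ⟨⟨a, ha⟩, h⟩
        have h1 : a = p := by simpa using congrArg (fun t => (t.1 : B)) h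
        have h2 : -a = q := by simpa using congrArg (fun t => (t.2 : B)) h
        ext
        simp [← h1, ← h2]) x hx'
  rw [← hz]
  exact FlatAux.deep n J _ s inf_le_left hAR z

open TensorProduct in
lemma FlatAux.base {A B C : Type*} [CommRing A] [CommRing B] [CommRing C]
    [Algebra A B] [Algebra B C] [Algebra A C] [IsScalarTower A B C] [Module.Flat A C]
    (m : Ideal A) (n : Ideal B) (hn : n = m.map (algebraMap A B)) :
    Function.Injective (n.subtype.lTensor C) := by
  have hmem : ∀ a : m, algebraMap A B a ∈ n := fun a => by
    rw [hn]; exact Ideal.mem_map_of_mem _ a.2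
  let φ : m →ₗ[A] n :=
    { toFun := fun a => ⟨algebraMap A B a, hmem a⟩
      map_add' := fun a b => by ext; simp
      map_smul' := fun a b => by ext; simp [Algebra.smul_def] }
  let α : C ⊗[A] m →ₗ[A] C ⊗[B] n := TensorProduct.lift
    (LinearMap.mk₂ A (fun c a => c ⊗ₜ[B] φ a)
      (fun _ _ _ => TensorProduct.add_tmul _ _ _)
      (fun r c a => by rw [TensorProduct.smul_tmul'])
      (fun _ _ _ => by rw [map_add, TensorProduct.tmul_add])
      (fun r c a => by rw [map_smul, TensorProduct.tmul_smul]))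
  have hα : ∀ c a, α (c ⊗ₜ a) = c ⊗ₜ φ a := fun _ _ => rfl
  have hsurj : Function.Surjective α := by
    intro z
    induction z with
    | zero => exact ⟨0, map_zero _⟩
    | add x y hx hy =>
      obtain ⟨x, rfl⟩ := hx
      obtain ⟨y, rfl⟩ := hy
      exact ⟨x + y, map_add _ _ _⟩
    | tmul c w =>
      obtain ⟨w, hw⟩ := w
      have hw' : w ∈ Submodule.span B (algebraMap A B '' m) := by
        rw [hn] at hw; exact hw
      induction hw' using Submodule.span_induction generalizing c with
      | mem x hx =>
        obtain ⟨a, ha, rfl⟩ := hx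
        exact ⟨c ⊗ₜ ⟨a, ha⟩, by rw [hα]; rfl⟩
      | zero => exact ⟨0, by rw [map_zero]; exact (TensorProduct.tmul_zero _ _).symm⟩
      | add x y hx hy h1 h2 =>
        have hx' : x ∈ n := by rw [hn]; exact hx
        have hy' : y ∈ n := by rw [hn]; exact hy
        obtain ⟨u, hu⟩ := h1 c hx'
        obtain ⟨v, hv⟩ := h2 c hy'
        exact ⟨u + v, by rw [map_add, hu, hv, ← TensorProduct.tmul_add]; rfl⟩
      | smul b x hx h1 =>
        have hx' : x ∈ n := by rw [hn]; exact hx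
        obtain ⟨u, hu⟩ := h1 (b • c) hx'
        exact ⟨u, by rw [hu, TensorProduct.smul_tmul]; rfl⟩
  have hinj : Function.Injective (m.subtype.lTensor C) :=
    Module.Flat.lTensor_preserves_injective_linearMap _ Subtype.val_injective
  have hcomm : ∀ t, TensorProduct.rid B C (n.subtype.lTensor C (α t)) =
      TensorProduct.rid A C (m.subtype.lTensor C t) := by
    intro t
    induction t with
    | zero => simp
    | add x y hx hy => simp only [map_add, hx, hy]
    | tmul c a =>
      rw [hα]
      simp [φ]
  intro u v huv
  obtain ⟨u, rfl⟩ := hsurj u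
  obtain ⟨v, rfl⟩ := hsurj v
  congr 1
  apply hinj
  apply (TensorProduct.rid A C).injective
  rw [← hcomm, ← hcomm, huv]

open TensorProduct in
lemma FlatAux.maximal_eq {A B : Type*} [CommRing A] [CommRing B]
    [IsLocalRing A] [IsLocalRing B] [Algebra A B] [IsLocalHom (algebraMap A B)]
    (hfield : IsField (TensorProduct A (IsLocalRing.ResidueField A) B)) :
    IsLocalRing.maximalIdeal B = (IsLocalRing.maximalIdeal A).map (algebraMap A B) := by
  have hle : (IsLocalRing.maximalIdeal A).map (algebraMap A B) ≤ IsLocalRing.maximalIdeal B :=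
    ((IsLocalRing.local_hom_TFAE (algebraMap A B)).out 0 2).mp ‹_›
  have hzero : ∀ b : B, (1 : IsLocalRing.ResidueField A) ⊗ₜ[A] b = 0 →
      b ∈ (IsLocalRing.maximalIdeal A).map (algebraMap A B) := by
    intro b hb
    have hb' : (Ideal.Quotient.mk (IsLocalRing.maximalIdeal A) 1) ⊗ₜ[A] b =
      (0 : (A ⧸ IsLocalRing.maximalIdeal A) ⊗[A] B) := hb
    have := congrArg (TensorProduct.quotTensorEquivQuotSMul B (IsLocalRing.maximalIdeal A)) hb'
    rw [map_zero, TensorProduct.quotTensorEquivQuotSMul_mk_tmul] at this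
    rw [one_smul, Submodule.Quotient.mk_eq_zero, Ideal.smul_top_eq_map] at this
    exact this
  have hsurj : ∀ t : IsLocalRing.ResidueField A ⊗[A] B, ∃ b : B, t = 1 ⊗ₜ b := by
    intro t
    induction t with
    | zero => exact ⟨0, by simp⟩
    | add x y hx hy =>
      obtain ⟨x, rfl⟩ := hx
      obtain ⟨y, rfl⟩ := hy
      exact ⟨x + y, by rw [TensorProduct.tmul_add]⟩
    | tmul c b =>
      obtain ⟨a, rfl⟩ := IsLocalRing.residue_surjective c
      refine ⟨a • b, ?_⟩
      rw [← TensorProduct.smul_tmul, Algebra.smul_def, mul_one]; rfl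
  refine le_antisymm (fun x hx => hzero x ?_) hle
  by_contra hne
  obtain ⟨y, hy⟩ := hfield.mul_inv_cancel hne
  obtain ⟨b, rfl⟩ := hsurj y
  have h1 : (1 : IsLocalRing.ResidueField A) ⊗ₜ[A] (x * b - 1) = 0 := by
    rw [TensorProduct.tmul_sub, sub_eq_zero]
    simpa [Algebra.TensorProduct.one_def] using hy
  have h2 := hle (hzero _ h1)
  have h3 : (1 : B) ∈ IsLocalRing.maximalIdeal B := by
    have := sub_mem (Ideal.mul_mem_right b _ hx) h2
    simpa using this
  exact (Ideal.ne_top_iff_one _).1 (IsLocalRing.maximalIdeal.isMaximal B).ne_top h3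


/-- Let `(A,m) → (B,n) → (C,p)` be local homomorphisms of Noetherian local
rings such that `B` and `C` are flat over `A` and the closed fiber `B ⊗[A] k(m)` is a field.
Then `C` is flat over `B`. -/
theorem flat_over_middle_of_flat_of_fiber_isField
    (A B C : Type*) [CommRing A] [CommRing B] [CommRing C]
    [IsLocalRing A] [IsLocalRing B] [IsLocalRing C]
    [IsNoetherianRing A] [IsNoetherianRing B] [IsNoetherianRing C]
    [Algebra A B] [Algebra B C] [Algebra A C] [IsScalarTower A B C]
    [IsLocalHom (algebraMap A B)] [IsLocalHom (algebraMap B C)]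
    [Module.Flat A B] [Module.Flat A C]
    (hfield : IsField (TensorProduct A (IsLocalRing.ResidueField A) B)) :
    Module.Flat B C := by
  have hnC : (IsLocalRing.maximalIdeal B).map (algebraMap B C) ≤ IsLocalRing.maximalIdeal C :=
    ((IsLocalRing.local_hom_TFAE (algebraMap B C)).out 0 2).mp ‹_›
  exact FlatAux.local_criterion (IsLocalRing.maximalIdeal B)
    (fun h => (IsLocalRing.maximalIdeal.isMaximal C).ne_top (top_le_iff.1 (h ▸ hnC)))
    (FlatAux.base (IsLocalRing.maximalIdeal A) _ (FlatAux.maximal_eq hfield))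
end

section
/- Let (A,m) and (R,n) be Noetherian local rings and A → R a flat local homomorphism such that the induced map on residue fields k(m) → k(n) is an isomorphism and R ⊗_A k(m) is a regular local ring of dimension n ≥ 1. Then there is an A-algebra isomorphism R̂ ≅ Â[[T₁,…,Tₙ]], where R̂ and Â denote the n-adic and m-adic completions. -/
open IsLocalRing

/-- A commutative ring is regular local of dimension `n` if it is Noetherian local and its
maximal ideal is generated by `n` elements with `n` equal to the Krull dimension. -/
def IsRegularLocalOfDim (T : Type*) [CommRing T] (n : ℕ) : Prop :=
  IsNoetherianRing T ∧ ∃ h : IsLocalRing T,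
    letI : IsLocalRing T := h
    ∃ s : Finset T, Ideal.span (s : Set T) = maximalIdeal T ∧
      s.card = n ∧ ringKrullDim T = n


lemma exists_evalHom {B S : Type*} [CommRing B] [CommRing S] (s : Ideal S) [IsAdicComplete s S]
    (g : B →+* S) {n : ℕ} (x : Fin n → S) (hx : ∀ i, x i ∈ s) :
    ∃ ψ : MvPowerSeries (Fin n) B →+* S, (∀ b, ψ (MvPowerSeries.C b) = g b) ∧
      (∀ i, ψ (MvPowerSeries.X i) = x i) ∧
      ∀ m p, (∀ α, g (MvPowerSeries.coeff α p) * α.prod (fun i e => x i ^ e) ∈ s ^ m) →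
        ψ p ∈ s ^ m := by
  let : WithIdeal S := ⟨s⟩
  let : UniformSpace B := ⊥
  have : DiscreteTopology B := ⟨rfl⟩
  have : IsUniformAddGroup B := inferInstance
  have hI : IsAdic s := rfl
  obtain ⟨h1, h2⟩ := hI.isAdicComplete_iff.mp ‹_›
  have hg : Continuous g := continuous_of_discreteTopology
  have ha : MvPowerSeries.HasEval x :=
    ⟨fun i => WithIdeal.isTopologicallyNilpotent_of_mem (hx i), by simp⟩
  refine ⟨MvPowerSeries.eval₂Hom hg ha, ?_, ?_, ?_⟩
  · intro b
    rw [MvPowerSeries.coe_eval₂Hom, MvPowerSeries.eval₂_C]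
  · intro b
    rw [MvPowerSeries.coe_eval₂Hom, MvPowerSeries.eval₂_X]
  · intro m p h
    rw [MvPowerSeries.coe_eval₂Hom]
    have hs := MvPowerSeries.hasSum_eval₂ hg ha p
    have hc : IsClosed ((s ^ m : Ideal S) : Set S) :=
      AddSubgroup.isClosed_of_isOpen (s ^ m).toAddSubgroup ((isAdic_iff.mp hI).1 m)
    exact hc.mem_of_tendsto hs (Filter.Eventually.of_forall fun F => Ideal.sum_mem _ fun α _ => h α)

/-- filtration -/
def filt {B : Type*} [CommRing B] (b : Ideal B) (n m : ℕ) : Ideal (MvPowerSeries (Fin n) B) where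
  carrier := {p | ∀ α, MvPowerSeries.coeff α p ∈ b ^ (m - α.degree)}
  add_mem' hp hq α := by simpa using add_mem (hp α) (hq α)
  zero_mem' α := by simp
  smul_mem' c p hp α := by
    classical
    simp only [smul_eq_mul, MvPowerSeries.coeff_mul]
    refine Ideal.sum_mem _ fun ij hij => Ideal.mul_mem_left _ _ ?_
    refine Ideal.pow_le_pow_right ?_ (hp ij.2)
    have : ij.1.degree + ij.2.degree = α.degree := by
      rw [← map_add, Finset.HasAntidiagonal.mem_antidiagonal.mp hij]
    omega

lemma filt_mul {B : Type*} [CommRing B] (b : Ideal B) (n i j : ℕ) :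
    filt b n i * filt b n j ≤ filt b n (i + j) := by
  classical
  rw [Ideal.mul_le]
  intro p hp q hq α
  simp only [MvPowerSeries.coeff_mul]
  refine Ideal.sum_mem _ fun ij hij => ?_
  have := Ideal.mul_mem_mul (hp ij.1) (hq ij.2)
  rw [← pow_add] at this
  refine Ideal.pow_le_pow_right ?_ this
  have : ij.1.degree + ij.2.degree = α.degree := by
    rw [← map_add, Finset.HasAntidiagonal.mem_antidiagonal.mp hij]
  omega

lemma pow_le_filt {B : Type*} [CommRing B] (b : Ideal B) (n m : ℕ) :
    (b.map MvPowerSeries.C ⊔ Ideal.span (Set.range (MvPowerSeries.X : Fin n → MvPowerSeries (Fin n) B))) ^ m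
      ≤ filt b n m := by
  classical
  have h1 : (b.map MvPowerSeries.C ⊔ Ideal.span (Set.range (MvPowerSeries.X : Fin n → MvPowerSeries (Fin n) B))) ≤ filt b n 1 := by
    rw [sup_le_iff, Ideal.map_le_iff_le_comap, Ideal.span_le]
    constructor
    · intro c hc α
      rw [MvPowerSeries.coeff_C]
      split_ifs with h
      · subst h; simpa using hc
      · simp
    · rintro _ ⟨i, rfl⟩ α
      rw [MvPowerSeries.coeff_X]
      split_ifs with h
      · subst h; simp
      · simp
  induction m with
  | zero => intro p _ α; simp
  | succ m ih =>
    rw [pow_succ]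
    exact (Ideal.mul_mono ih h1).trans (filt_mul b n m 1)

lemma exists_surj_evalHom {B S : Type*} [CommRing B] [CommRing S] (s : Ideal S)
    [IsAdicComplete s S] (b : Ideal B) [IsAdicComplete b B]
    (g : B →+* S) {n : ℕ} (x : Fin n → S) (hs : s = b.map g ⊔ Ideal.span (Set.range x))
    (hsurj : ∀ y : S, ∃ c : B, y - g c ∈ s) :
    ∃ ψ : MvPowerSeries (Fin n) B →+* S, (∀ b, ψ (MvPowerSeries.C b) = g b) ∧
      Function.Surjective ψ := by
  classical
  have hx : ∀ i, x i ∈ s := fun i => by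
    rw [hs]; exact Ideal.mem_sup_right (Ideal.subset_span ⟨i, rfl⟩)
  have hb : b.map g ≤ s := by rw [hs]; exact le_sup_left
  obtain ⟨ψ, hC, hX, hcont⟩ := exists_evalHom s g x hx
  refine ⟨ψ, hC, ?_⟩
  have hfilt : ∀ m p, p ∈ filt b n m → ψ p ∈ s ^ m := by
    intro m p hp
    refine hcont m p fun α => ?_
    have h1 : g (MvPowerSeries.coeff α p) ∈ s ^ (m - α.degree) :=
      Ideal.pow_right_mono hb _ (by
        rw [← Ideal.map_pow]; exact Ideal.mem_map_of_mem g (hp α))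
    have h2 : α.prod (fun i e => x i ^ e) ∈ s ^ α.degree := by
      rw [Finsupp.degree_eq_sum, Finsupp.prod_fintype _ _ (by simp), ← Finset.prod_pow_eq_pow_sum]
      exact Ideal.prod_mem_prod fun i _ => Ideal.pow_mem_pow (hx i) _
    have := Ideal.mul_mem_mul h1 h2
    rw [← pow_add] at this
    exact Ideal.pow_le_pow_right (by omega) this
  set J := (b.map MvPowerSeries.C ⊔ Ideal.span (Set.range (MvPowerSeries.X : Fin n → MvPowerSeries (Fin n) B))) with hJ
  have hmapJ : J.map ψ = s := by
    rw [hJ, Ideal.map_sup, Ideal.map_map, Ideal.map_span, ← Set.range_comp, hs]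
    congr 1
    · congr 1; ext c; exact hC c
    · congr 2; ext i; exact hX i
  have step : ∀ k, ∀ y ∈ s ^ k, ∃ p ∈ filt b n k, y - ψ p ∈ s ^ (k + 1) := by
    intro k y hy
    rw [← hmapJ, ← Ideal.map_pow, Ideal.map] at hy
    induction hy using Submodule.span_induction with
    | mem y hy =>
      obtain ⟨p, hp, rfl⟩ := hy
      exact ⟨p, pow_le_filt b n k hp, by simp⟩
    | zero => exact ⟨0, zero_mem _, by simp⟩
    | add y z _ _ h1 h2 =>
      obtain ⟨p, hp, h1⟩ := h1
      obtain ⟨q, hq, h2⟩ := h2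
      exact ⟨p + q, add_mem hp hq, by
        rw [map_add, add_sub_add_comm]; exact add_mem h1 h2⟩
    | smul r y _ h1 =>
      obtain ⟨p, hp, h1⟩ := h1
      obtain ⟨c, hc⟩ := hsurj r
      refine ⟨MvPowerSeries.C c * p, Ideal.mul_mem_left _ _ hp, ?_⟩
      have : r • y - ψ (MvPowerSeries.C c * p) = r * (y - ψ p) + (r - g c) * ψ p := by
        rw [map_mul, hC, smul_eq_mul]; ring
      rw [this]
      refine add_mem (Ideal.mul_mem_left _ _ h1) ?_
      rw [pow_succ']
      exact Ideal.mul_mem_mul hc (hfilt k p hp)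
  intro y
  choose! P hP1 hP2 using step
  -- partial sums
  let q : ℕ → MvPowerSeries (Fin n) B := fun N => Nat.rec 0 (fun k q => q + P k (y - ψ q)) N
  have hq0 : q 0 = 0 := rfl
  have hqs : ∀ k, q (k + 1) = q k + P k (y - ψ (q k)) := fun k => rfl
  have hq : ∀ N, y - ψ (q N) ∈ s ^ N := by
    intro N
    induction N with
    | zero => simp
    | succ N ih =>
      have := hP2 N _ ih
      rw [hqs, map_add, ← sub_sub]; exact this
  have hqd : ∀ N M, N ≤ M → q M - q N ∈ filt b n N := by
    intro N M h
    induction M, h using Nat.le_induction with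
    | base => simp
    | succ M h ih =>
      have h1 : P M (y - ψ (q M)) ∈ filt b n N := fun α =>
        Ideal.pow_le_pow_right (by omega) (hP1 M _ (hq M) α)
      rw [hqs, add_sub_right_comm]
      exact add_mem ih h1
  have hlim : ∀ α : Fin n →₀ ℕ, ∃ c : B, ∀ N, c - MvPowerSeries.coeff α (q N) ∈ b ^ (N - α.degree) := by
    intro α
    obtain ⟨L, hL⟩ := IsPrecomplete.prec (inferInstance : IsPrecomplete b B)
      (f := fun N => MvPowerSeries.coeff α (q (N + α.degree))) (by
        intro m k hmk
        rw [SModEq.sub_mem, smul_eq_mul, Ideal.mul_top, ← neg_mem_iff, neg_sub, ← map_sub]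
        have := hqd (m + α.degree) (k + α.degree) (by omega) α
        simpa using this)
    refine ⟨L, fun N => ?_⟩
    rcases le_total α.degree N with h | h
    · have := hL (N - α.degree)
      rw [SModEq.sub_mem, smul_eq_mul, Ideal.mul_top, ← neg_mem_iff, neg_sub,
        Nat.sub_add_cancel h] at this
      exact this
    · rw [Nat.sub_eq_zero_of_le h]; simp
  choose c hc using hlim
  let p : MvPowerSeries (Fin n) B := fun α => c α
  have hp : ∀ N, p - q N ∈ filt b n N := by
    intro N α
    rw [map_sub]
    exact hc α N
  refine ⟨p, ?_⟩
  rw [← sub_eq_zero]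
  refine IsHausdorff.haus (inferInstance : IsHausdorff s S) _ fun N => ?_
  rw [SModEq.zero, smul_eq_mul, Ideal.mul_top]
  have h1 := hfilt N _ (hp N)
  rw [map_sub] at h1
  have := sub_mem h1 (hq N)
  rwa [sub_sub_sub_cancel_right] at this


lemma exists_completionMap {A R : Type*} [CommRing A] [CommRing R] [Algebra A R] (I : Ideal A) (J : Ideal R)
    (h : I.map (algebraMap A R) ≤ J) :
    ∃ g : AdicCompletion I A →+* AdicCompletion J R,
      ∀ a, g (algebraMap A _ a) = algebraMap R _ (algebraMap A R a) := by
  have hk : ∀ k, I ^ k ≤ (J ^ k).comap (algebraMap A R) := fun k => by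
    rw [← Ideal.map_le_iff_le_comap, Ideal.map_pow]
    exact Ideal.pow_right_mono h k
  let f : (k : ℕ) → AdicCompletion I A →+* R ⧸ J ^ k := fun k =>
    (Ideal.quotientMap (J ^ k) (algebraMap A R) (hk k)).comp (AdicCompletion.evalₐ I k).toRingHom
  have hf : ∀ {m n : ℕ} (hle : m ≤ n), (Ideal.Quotient.factorPow J hle).comp (f n) = f m := by
    intro m n hmn
    ext x
    obtain ⟨y, rfl⟩ := AdicCompletion.mk_surjective _ _ x
    simp only [f, RingHom.comp_apply, AlgHom.toRingHom_eq_coe, RingHom.coe_coe,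
      AdicCompletion.evalₐ_mk, Ideal.quotientMap_mk]
    have h1 := AdicCompletion.Ideal.mk_eq_mk I hmn y
    have h2 := congrArg (Ideal.quotientMap (J ^ m) (algebraMap A R) (hk m)) h1
    rw [Ideal.quotientMap_mk, Ideal.quotientMap_mk] at h2
    exact h2
  refine ⟨AdicCompletion.liftRingHom J f hf, fun a => ?_⟩
  refine AdicCompletion.ext_evalₐ fun k => ?_
  rw [AdicCompletion.evalₐ_liftRingHom J f hf]
  simp [f]

lemma span_X_of_constantCoeff {B : Type*} [CommRing B] {n : ℕ} (p : MvPowerSeries (Fin n) B)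
    (hp : MvPowerSeries.constantCoeff p = 0) : p ∈ Ideal.span (Set.range (MvPowerSeries.X : Fin n → MvPowerSeries (Fin n) B)) := by
  classical
  let q : Fin n → MvPowerSeries (Fin n) B := fun i α =>
    if ∀ j < i, α j = 0 then MvPowerSeries.coeff (α + Finsupp.single i 1) p else 0
  have : p = ∑ i, q i * MvPowerSeries.X i := by
    ext α
    rw [map_sum]
    have hq : ∀ i, MvPowerSeries.coeff α (q i * MvPowerSeries.X i) =
      if (∀ j < i, α j = 0) ∧ α i ≠ 0 then MvPowerSeries.coeff α p else 0 := by
      intro i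
      rw [MvPowerSeries.X_def, MvPowerSeries.coeff_mul_monomial, mul_one]
      by_cases hi : α i = 0
      · rw [if_neg, if_neg]
        · simp [hi]
        · intro h; have := h i; simp [hi] at this
      · have hle : Finsupp.single i 1 ≤ α := by
          rw [Finsupp.single_le_iff]; omega
        rw [if_pos hle]
        change (if ∀ j < i, (α - Finsupp.single i 1 : Fin n →₀ ℕ) j = 0 then MvPowerSeries.coeff ((α - Finsupp.single i 1) + Finsupp.single i 1) p else 0) = _
        rw [tsub_add_cancel_of_le hle]
        congr 1
        simp only [hi, ne_eq, not_false_eq_true, and_true, eq_iff_iff]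
        refine forall₂_congr fun j hj => ?_
        simp [hj.ne']
    simp only [hq]
    by_cases h0 : α = 0
    · subst h0
      simpa using hp
    · have hex : ∃ i, α i ≠ 0 := by
        by_contra! h
        exact h0 (Finsupp.ext h)
      have hne : (Finset.univ.filter fun i => α i ≠ 0).Nonempty := by
        obtain ⟨i, hi⟩ := hex
        exact ⟨i, by simpa using hi⟩
      set i0 := (Finset.univ.filter fun i => α i ≠ 0).min' hne with hi0
      have h1 : α i0 ≠ 0 := by
        have := Finset.min'_mem _ hne
        simpa using this
      have h2 : ∀ j < i0, α j = 0 := by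
        intro j hj
        by_contra h
        exact absurd (Finset.min'_le (Finset.univ.filter fun i => α i ≠ 0) j (by simpa using h)) (not_le.mpr hj)
      rw [Finset.sum_eq_single i0]
      · rw [if_pos ⟨h2, h1⟩]
      · intro b _ hb
        rw [if_neg]
        rintro ⟨h3, h4⟩
        rcases lt_or_gt_of_ne hb with h | h
        · exact h4 (h2 b h)
        · exact h1 (h3 i0 h)
      · simp
  rw [this]
  exact Ideal.sum_mem _ fun i _ => Ideal.mul_mem_left _ _ (Ideal.subset_span ⟨i, rfl⟩)

lemma dim_mvPowerSeries_le (κ : Type*) [Field κ] (n : ℕ) :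
    ringKrullDim (MvPowerSeries (Fin n) κ) ≤ n := by
  have hmax : maximalIdeal (MvPowerSeries (Fin n) κ) = Ideal.span (Set.range MvPowerSeries.X) := by
    apply le_antisymm
    · intro p hp
      apply span_X_of_constantCoeff
      by_contra h
      exact hp (MvPowerSeries.isUnit_iff_constantCoeff.mpr (isUnit_iff_ne_zero.mpr h))
    · rw [Ideal.span_le]
      rintro _ ⟨i, rfl⟩ h
      have := MvPowerSeries.isUnit_iff_constantCoeff.mp h
      simp at this
  refine (ringKrullDim_le_spanFinrank_maximalIdeal (R := MvPowerSeries (Fin n) κ)).trans ?_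
  rw [hmax]
  have h := Submodule.spanFinrank_span_le_ncard_of_finite (R := MvPowerSeries (Fin n) κ) (Set.finite_range (MvPowerSeries.X : Fin n → MvPowerSeries (Fin n) κ))
  have h2 : (Set.range (MvPowerSeries.X : Fin n → MvPowerSeries (Fin n) κ)).ncard ≤ n := by
    rw [← Set.image_univ]
    exact (Set.ncard_image_le).trans (by simp)
  exact_mod_cast h.trans h2

lemma dim_le_of_faithfullyFlat (A B : Type*) [CommRing A] [CommRing B] [Algebra A B]
    [Module.FaithfullyFlat A B] : ringKrullDim A ≤ ringKrullDim B := by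
  refine iSup_le fun l => ?_
  obtain ⟨P, hP⟩ := PrimeSpectrum.comap_surjective_of_faithfullyFlat (A := A) (B := B) l.last
  have : P.asIdeal.LiesOver l.last.asIdeal := ⟨by rw [← hP]; rfl⟩
  obtain ⟨L, hL, -⟩ := Ideal.exists_ltSeries_of_hasGoingDown l P.asIdeal
  rw [← hL]
  exact le_iSup (fun l : LTSeries (PrimeSpectrum B) => (l.length : WithBot ℕ∞)) L


lemma exists_sum_of_coeff_mem {A B : Type*} [CommRing A] [CommRing B] [Algebra A B] {n r : ℕ}
    (c : Fin r → A) (p : MvPowerSeries (Fin n) B)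
    (hp : ∀ α, MvPowerSeries.coeff α p ∈ (Ideal.span (Set.range c)).map (algebraMap A B)) :
    ∃ g : Fin r → MvPowerSeries (Fin n) B, p = ∑ j, MvPowerSeries.C (algebraMap A B (c j)) * g j := by
  have : ∀ α, ∃ d : Fin r → B, ∑ j, d j * algebraMap A B (c j) = MvPowerSeries.coeff α p := by
    intro α
    have h := hp α
    rw [Ideal.map_span, ← Set.range_comp, Ideal.mem_span_range_iff_exists_fun] at h
    exact h
  choose d hd using this
  let g : Fin r → MvPowerSeries (Fin n) B := fun j α => d α j
  have hg : ∀ j α, MvPowerSeries.coeff α (g j) = d α j := fun _ _ => rfl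
  refine ⟨g, ?_⟩
  ext α
  rw [map_sum, ← hd]
  refine Finset.sum_congr rfl fun j _ => ?_
  rw [MvPowerSeries.coeff_C_mul, mul_comm, hg]

lemma inj_of_flat {A B S : Type*} [CommRing A] [CommRing B] [CommRing S] [Algebra A B]
    [Algebra A S] [Module.Flat A S] (m : Ideal A) (hm : m.FG)
    [IsHausdorff (m.map (algebraMap A B)) B] {n : ℕ}
    (ψ : MvPowerSeries (Fin n) B →+* S) (hψ : Function.Surjective ψ)
    (hA : ∀ a, ψ (MvPowerSeries.C (algebraMap A B a)) = algebraMap A S a)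
    (hker : ∀ p, ψ p = 0 → ∀ α, MvPowerSeries.coeff α p ∈ m.map (algebraMap A B)) :
    Function.Injective ψ := by
  obtain ⟨r, c, hc⟩ := Submodule.fg_iff_exists_fin_generating_family.mp hm
  change Ideal.span (Set.range c) = m at hc
  have key : ∀ p, ψ p = 0 → ∃ k : Fin r → MvPowerSeries (Fin n) B, (∀ j, ψ (k j) = 0) ∧
      p = ∑ j, MvPowerSeries.C (algebraMap A B (c j)) * k j := by
    intro p hp
    obtain ⟨g, hg⟩ := exists_sum_of_coeff_mem c p (by rw [hc]; exact hker p hp)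
    have h0 : ∑ j, c j • ψ (g j) = 0 := by
      rw [← hp, hg, map_sum]
      refine Finset.sum_congr rfl fun j _ => ?_
      rw [map_mul, hA, Algebra.smul_def]
    obtain ⟨t, a, y, h1, h2⟩ := Module.Flat.isTrivialRelation_of_sum_smul_eq_zero (R := A) (M := S) (f := c) (x := fun j => ψ (g j)) h0
    choose h hh using fun l => hψ (y l)
    refine ⟨fun j => g j - ∑ l, MvPowerSeries.C (algebraMap A B (a j l)) * h l, fun j => ?_, ?_⟩
    · rw [map_sub, map_sum, sub_eq_zero]
      refine (h1 j).trans ?_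
      refine Finset.sum_congr rfl fun l _ => ?_
      rw [map_mul, hA, hh, Algebra.smul_def]
    · simp only [mul_sub, Finset.sum_sub_distrib, Finset.mul_sum]
      rw [← hg, Finset.sum_comm]
      have : ∀ l, ∑ j, MvPowerSeries.C (algebraMap A B (c j)) * (MvPowerSeries.C (algebraMap A B (a j l)) * h l) = 0 := by
        intro l
        simp only [← mul_assoc, ← map_mul]
        rw [← Finset.sum_mul, ← map_sum, ← map_sum]
        have h3 := h2 l
        simp only [h3, map_zero, zero_mul]
      simp [this]
  have hall : ∀ k p, ψ p = 0 → ∀ α, MvPowerSeries.coeff α p ∈ (m.map (algebraMap A B)) ^ k := by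
    intro k
    induction k with
    | zero => simp
    | succ k ih =>
      intro p hp α
      obtain ⟨q, hq, rfl⟩ := key p hp
      rw [map_sum]
      refine Ideal.sum_mem _ fun j _ => ?_
      rw [MvPowerSeries.coeff_C_mul, pow_succ']
      refine Ideal.mul_mem_mul (Ideal.mem_map_of_mem _ ?_) (ih _ (hq j) α)
      rw [← hc]
      exact Ideal.subset_span ⟨j, rfl⟩
  rw [injective_iff_map_eq_zero]
  intro p hp
  ext α
  refine IsHausdorff.haus (inferInstance : IsHausdorff (m.map (algebraMap A B)) B) _ fun k => ?_
  rw [SModEq.zero, smul_eq_mul, Ideal.mul_top]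
  exact hall k p hp α

lemma ker_coeff_mem {A B S T : Type*} [CommRing A] [CommRing B] [CommRing S] [CommRing T]
    [Algebra A B] [Algebra A S] (m : Ideal A) (hm : m.FG) [IsLocalRing B]
    (hB : maximalIdeal B = m.map (algebraMap A B)) {n : ℕ}
    (ψ : MvPowerSeries (Fin n) B →+* S) (hψ : Function.Surjective ψ)
    (hA : ∀ a, ψ (MvPowerSeries.C (algebraMap A B a)) = algebraMap A S a)
    (π : S →+* T) (hπ : Function.Surjective π) (hπm : ∀ a ∈ m, π (algebraMap A S a) = 0)
    (hT : (n : WithBot ℕ∞) ≤ ringKrullDim T) 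
    (p : MvPowerSeries (Fin n) B) (hp : ψ p = 0) (α) :
     MvPowerSeries.coeff α p ∈ m.map (algebraMap A B) := by
  obtain ⟨r, c, hc⟩ := Submodule.fg_iff_exists_fin_generating_family.mp hm
  change Ideal.span (Set.range c) = m at hc
  let ρ : MvPowerSeries (Fin n) B →+* MvPowerSeries (Fin n) (ResidueField B) :=
    MvPowerSeries.map (residue B)
  have hρ : Function.Surjective ρ := by
    intro q
    choose f hf using fun α => residue_surjective (MvPowerSeries.coeff α q)
    let F : MvPowerSeries (Fin n) B := f
    refine ⟨F, ?_⟩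
    ext α
    exact (MvPowerSeries.coeff_map (residue B) α F).trans (hf α)
  have hk : ∀ p, ρ p = 0 → ∀ α, MvPowerSeries.coeff α p ∈ m.map (algebraMap A B) := by
    intro p hp α
    rw [← hB, ← residue_eq_zero_iff, ← MvPowerSeries.coeff_map]
    change MvPowerSeries.coeff α (ρ p) = 0
    rw [hp, map_zero]
  have hle : RingHom.ker ρ ≤ RingHom.ker (π.comp ψ) := by
    intro p hp
    obtain ⟨g, rfl⟩ := exists_sum_of_coeff_mem c p (by rw [hc]; exact hk p hp)
    rw [RingHom.mem_ker, map_sum]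
    refine Finset.sum_eq_zero fun j _ => ?_
    rw [map_mul, RingHom.comp_apply, hA, hπm, zero_mul]
    rw [← hc]
    exact Ideal.subset_span ⟨j, rfl⟩
  let φ : MvPowerSeries (Fin n) (ResidueField B) →+* T := ρ.liftOfSurjective hρ ⟨π.comp ψ, hle⟩
  have hφ : ∀ p, φ (ρ p) = π (ψ p) := fun p => RingHom.liftOfRightInverse_comp_apply _ _ _ _ _
  have hφs : Function.Surjective φ := by
    intro t
    obtain ⟨s, rfl⟩ := hπ t
    obtain ⟨q, rfl⟩ := hψ s
    exact ⟨ρ q, hφ q⟩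
  apply hk
  by_contra h0
  have h1 := ringKrullDim_succ_le_of_surjective φ hφs (r := ρ p)
    (mem_nonZeroDivisors_of_ne_zero h0) (by rw [hφ, hp, map_zero])
  have h2 := h1.trans (dim_mvPowerSeries_le (ResidueField B) n)
  have h3 : ((n : WithBot ℕ∞) + 1) ≤ n := (add_le_add_left hT 1).trans h2
  have h4 : n + 1 ≤ n := by exact_mod_cast h3
  omega


lemma exists_gens {A R : Type*} [CommRing A] [CommRing R] [IsLocalRing A] [IsLocalRing R]
    [Algebra A R] [IsLocalHom (algebraMap A R)] {n : ℕ}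
    (hreg : IsRegularLocalOfDim (TensorProduct A (ResidueField A) R) n) :
    ringKrullDim (R ⧸ (maximalIdeal A).map (algebraMap A R)) = n ∧
    ∃ x : Fin n → R, maximalIdeal R =
      (maximalIdeal A).map (algebraMap A R) ⊔ Ideal.span (Set.range x) := by
  obtain ⟨-, hloc, s, hs, hcard, hdim⟩ := hreg
  let I := (maximalIdeal A).map (algebraMap A R)
  let e : (R ⧸ I) ≃+* TensorProduct A (ResidueField A) R :=
    (Algebra.TensorProduct.quotIdealMapEquivQuotTensor R (maximalIdeal A)).toRingEquiv
  have hIle : I ≤ maximalIdeal R := ((local_hom_TFAE (algebraMap A R)).out 0 2).mp ‹_›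
  refine ⟨(ringKrullDim_eq_of_ringEquiv e).trans hdim, ?_⟩
  let f : Fin n ≃ s := (Finset.equivFinOfCardEq hcard).symm
  choose x hx using fun i => Ideal.Quotient.mk_surjective (I := I) (e.symm (f i : _))
  refine ⟨x, ?_⟩
  let q : R →+* TensorProduct A (ResidueField A) R := e.toRingHom.comp (Ideal.Quotient.mk I)
  have hq : Function.Surjective q := e.surjective.comp Ideal.Quotient.mk_surjective
  have hker : RingHom.ker q = I := by
    ext r
    simp [q, RingHom.mem_ker, Ideal.Quotient.eq_zero_iff_mem]
  have hmax : maximalIdeal R = (maximalIdeal (TensorProduct A (ResidueField A) R)).comap q := by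
    have := Ideal.comap_isMaximal_of_surjective q hq (K := maximalIdeal (TensorProduct A (ResidueField A) R))
    exact (eq_maximalIdeal this).symm
  have hspan : (Ideal.span (Set.range x)).map q = maximalIdeal (TensorProduct A (ResidueField A) R) := by
    rw [Ideal.map_span, ← hs, ← Set.range_comp]
    congr 1
    have : ∀ i, (q ∘ x) i = f i := by
      intro i
      simp [q, hx]
    ext y
    constructor
    · rintro ⟨i, rfl⟩
      rw [this]
      exact (f i).2
    · intro hy
      exact ⟨f.symm ⟨y, hy⟩, by rw [this]; simp⟩
  rw [hmax, ← hspan, Ideal.comap_map_of_surjective' q hq, hker, sup_comm]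

/-- Let `(A,m)` and `(R,n)` be Noetherian local rings and `A → R` a flat
local homomorphism inducing an isomorphism on residue fields, such that the closed fiber
`R ⊗_A k(m)` is a regular local ring of dimension `n ≥ 1`. Then there is an `A`-algebra
isomorphism `R̂ ≅ Â[[T₁,…,Tₙ]]` of the maximal-adic completions. -/
theorem completion_iso_powerSeries_of_regular_fiber
    (A R : Type*) [CommRing A] [CommRing R] [IsLocalRing A] [IsLocalRing R]
    [IsNoetherianRing A] [IsNoetherianRing R] [Algebra A R]
    [IsLocalHom (algebraMap A R)] [Module.Flat A R]
    (hres : Function.Bijective (ResidueField.map (algebraMap A R)))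
    (n : ℕ) (hn : 1 ≤ n)
    (hreg : IsRegularLocalOfDim (TensorProduct A (ResidueField A) R) n) :
    letI : Algebra A (AdicCompletion (maximalIdeal R) R) :=
      ((algebraMap R (AdicCompletion (maximalIdeal R) R)).comp (algebraMap A R)).toAlgebra
    Nonempty (AdicCompletion (maximalIdeal R) R ≃ₐ[A]
      MvPowerSeries (Fin n) (AdicCompletion (maximalIdeal A) A)) := by
  obtain ⟨hdim, x, hx⟩ := exists_gens hreg
  have hle : (maximalIdeal A).map (algebraMap A R) ≤ maximalIdeal R := by
    rw [hx]; exact le_sup_left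
  obtain ⟨g, hg⟩ := exists_completionMap (maximalIdeal A) (maximalIdeal R) hle
  have hcomp : g.comp (algebraMap A _) = (algebraMap R _).comp (algebraMap A R) :=
    RingHom.ext hg
  have hB := AdicCompletion.maximalIdeal_eq_map (R := A)
  obtain ⟨ψ, hC, hψ⟩ := exists_surj_evalHom
    (maximalIdeal (AdicCompletion (maximalIdeal R) R))
    (maximalIdeal (AdicCompletion (maximalIdeal A) A)) g
    (fun i => algebraMap R _ (x i)) (by
      rw [AdicCompletion.maximalIdeal_eq_map, AdicCompletion.maximalIdeal_eq_map, Ideal.map_map, hcomp,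
        ← Ideal.map_map]
      have h := congrArg (Ideal.map (algebraMap R (AdicCompletion (maximalIdeal R) R))) hx
      rw [Ideal.map_sup, Ideal.map_span, ← Set.range_comp] at h
      exact h) (by
      intro y
      obtain ⟨z, hz⟩ := (AdicCompletion.residueField_map_bijective R).2 (residue _ y)
      obtain ⟨w, rfl⟩ := hres.2 z
      obtain ⟨a, rfl⟩ := residue_surjective w
      refine ⟨algebraMap A _ a, ?_⟩
      rw [ResidueField.map_residue, ResidueField.map_residue] at hz
      rw [hg, ← residue_eq_zero_iff, map_sub, ← hz, sub_self])
  have hA : ∀ a, ψ (MvPowerSeries.C (algebraMap A _ a)) =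
      algebraMap A (AdicCompletion (maximalIdeal R) R) a := by
    intro a
    rw [hC, hg]
    rfl
  have hflat : Module.Flat R (AdicCompletion (maximalIdeal R) R) :=
    AdicCompletion.flat_of_isNoetherian _
  have : Module.Flat A (AdicCompletion (maximalIdeal R) R) := Module.Flat.trans A R _
  have hff : Module.FaithfullyFlat R (AdicCompletion (maximalIdeal R) R) :=
    Module.FaithfullyFlat.of_flat_of_isLocalHom
  have : IsHausdorff ((maximalIdeal A).map (algebraMap A (AdicCompletion (maximalIdeal A) A)))
      (AdicCompletion (maximalIdeal A) A) := by
    rw [← hB]; infer_instance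
  have hinj : Function.Injective ψ := by
    refine inj_of_flat (maximalIdeal A) (Ideal.fg_of_isNoetherianRing _) ψ hψ hA fun p hp α => ?_
    refine ker_coeff_mem (maximalIdeal A) (Ideal.fg_of_isNoetherianRing _) hB ψ hψ hA
      (T := TensorProduct R (R ⧸ (maximalIdeal A).map (algebraMap A R)) (AdicCompletion (maximalIdeal R) R))
      (Algebra.TensorProduct.includeRight (R := R) (A := R ⧸ (maximalIdeal A).map (algebraMap A R)) (B := AdicCompletion (maximalIdeal R) R)).toRingHom ?_ ?_ ?_ p hp α
    · exact Algebra.TensorProduct.includeRight_surjective _ Ideal.Quotient.mk_surjective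
    · intro a ha
      rw [IsScalarTower.algebraMap_apply A R]
      change Algebra.TensorProduct.includeRight (algebraMap R _ _) = _
      rw [AlgHom.commutes, Algebra.TensorProduct.algebraMap_apply]
      have : algebraMap R (R ⧸ (maximalIdeal A).map (algebraMap A R)) (algebraMap A R a) = 0 :=
        Ideal.Quotient.eq_zero_iff_mem.mpr (Ideal.mem_map_of_mem _ ha)
      rw [this, TensorProduct.zero_tmul]
    · rw [← hdim]
      exact dim_le_of_faithfullyFlat _ _
  have hbij : Function.Bijective ψ := ⟨hinj, hψ⟩
  let e := (RingEquiv.ofBijective ψ hbij).symm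
  refine ⟨@AlgEquiv.ofRingEquiv _ _ _ _ _ _ (_) _ e fun a => ?_⟩
  rw [RingEquiv.symm_apply_eq, RingEquiv.ofBijective_apply, MvPowerSeries.algebraMap_apply, hC, hg]
  rfl
end

section
/- Let (A,m) and (R,n) be Noetherian local rings and A → R a flat local homomorphism with k(n) separable over k(m) and R ⊗_A k(m) regular of dimension n ≥ 1. Let (B,J) be a Noetherian local ring with a flat local homomorphism A → B satisfying mB = J and k(J) ≅ k(n) over k(m). Then R̂ ≅ B̂[[T₁,…,Tₙ]] as A-algebras. -/
open IsLocalRing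

namespace CompIso

lemma flat_quot {A B : Type*} [CommRing A] [CommRing B] [Algebra A B] [Module.Flat A B]
    (I : Ideal A) :
    (algebraMap (A ⧸ I) (B ⧸ I.map (algebraMap A B))).Flat := by
  have h : Module.Flat (A ⧸ I) (B ⧸ I.map (algebraMap A B)) :=
    Module.Flat.of_linearEquiv (Algebra.TensorProduct.quotIdealMapEquivQuotTensor B I).toLinearEquiv
  exact RingHom.flat_algebraMap_iff.mpr h

lemma fs_quot {A B L : Type*} [CommRing A] [CommRing B] [CommRing L] [Algebra A B]
    [IsLocalRing A] [Module.Flat A B]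
    (g : ResidueField A →+* L) (hg : g.FormallySmooth) (q : B →+* L)
    (hq : Function.Surjective q) (hker : RingHom.ker q = (maximalIdeal A).map (algebraMap A B))
    (comm : q.comp (algebraMap A B) = g.comp (residue A)) (i : ℕ) :
    (algebraMap (A ⧸ (maximalIdeal A) ^ (i + 1))
      (B ⧸ ((maximalIdeal A) ^ (i + 1)).map (algebraMap A B))).FormallySmooth := by
  induction i with
  | zero =>
    have h1 : (maximalIdeal A) ^ (0 + 1) ≤ RingHom.ker (residue A) := by simp [ker_residue]
    have h2 : ((maximalIdeal A) ^ (0 + 1)).map (algebraMap A B) ≤ RingHom.ker q := by simp [hker]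
    refine RingHom.FormallySmooth.of_flat_of_ker_eq_map_of_square_zero _ (flat_quot _)
      (Ideal.Quotient.lift _ (residue A) (fun a ha => h1 ha))
      (Ideal.Quotient.lift _ q (fun a ha => h2 ha)) g ?_ ?_ ?_ ?_ ?_ hg
    · exact Ideal.Quotient.lift_surjective_of_surjective _ _ residue_surjective
    · exact Ideal.Quotient.lift_surjective_of_surjective _ _ hq
    · ext x
      exact congr($comm x)
    · rw [Ideal.ker_quotient_lift, ker_residue, ← Ideal.map_pow, Ideal.map_eq_bot_iff_le_ker,
        Ideal.mk_ker]
      exact Ideal.pow_le_pow_right (by lia)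
    · rw [Ideal.ker_quotient_lift, Ideal.ker_quotient_lift]
      rw [hker, ker_residue, Ideal.map_map, Ideal.map_map]
      congr 1
  | succ i ih =>
    have h1 : (maximalIdeal A) ^ (i + 1 + 1) ≤ (maximalIdeal A) ^ (i + 1) :=
      Ideal.pow_le_pow_right (by lia)
    have h2 := Ideal.map_mono (f := algebraMap A B) h1
    refine RingHom.FormallySmooth.of_flat_of_ker_eq_map_of_square_zero _ (flat_quot _)
      (Ideal.Quotient.factor h1) (Ideal.Quotient.factor h2) _ ?_ ?_ ?_ ?_ ?_ ih
    · exact Ideal.Quotient.factor_surjective _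
    · exact Ideal.Quotient.factor_surjective _
    · ext x
      rfl
    · rw [Ideal.Quotient.factor_ker, ← Ideal.map_pow, ← pow_mul]
      rw [Ideal.map_eq_bot_iff_le_ker, Ideal.mk_ker]
      exact Ideal.pow_le_pow_right (by lia)
    · rw [Ideal.Quotient.factor_ker, Ideal.Quotient.factor_ker, Ideal.map_map, Ideal.map_map]
      congr 1

lemma lift_step {A B T T' : Type*} [CommRing A] [CommRing B] [CommRing T] [CommRing T']
    [Algebra A B] [Algebra A T] [Algebra A T'] (I : Ideal A)
    (hfs : (algebraMap (A ⧸ I) (B ⧸ I.map (algebraMap A B))).FormallySmooth)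
    (hI : I.map (algebraMap A T) = ⊥) (p : T →ₐ[A] T') (hp : Function.Surjective p)
    (hnil : IsNilpotent (RingHom.ker p)) (h : B →ₐ[A] T') :
    ∃ h' : B →ₐ[A] T, p.comp h' = h := by
  have hT : ∀ a ∈ I, algebraMap A T a = 0 := fun a ha => by
    have := Ideal.mem_map_of_mem (algebraMap A T) ha
    rwa [hI] at this
  have hT' : ∀ a ∈ I, algebraMap A T' a = 0 := fun a ha => by
    rw [← p.commutes, hT a ha, map_zero]
  let : Algebra (A ⧸ I) T := (Ideal.Quotient.lift I (algebraMap A T) hT).toAlgebra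
  let : Algebra (A ⧸ I) T' := (Ideal.Quotient.lift I (algebraMap A T') hT').toAlgebra
  have hfs' : Algebra.FormallySmooth (A ⧸ I) (B ⧸ I.map (algebraMap A B)) := RingHom.formallySmooth_algebraMap.mp hfs
  have hB : ∀ b ∈ I.map (algebraMap A B), h.toRingHom b = 0 := by
    intro b hb
    have : I.map (algebraMap A B) ≤ RingHom.ker h.toRingHom := by
      rw [Ideal.map_le_iff_le_comap]
      intro a ha
      simp [hT' a ha]
    exact this hb
  let hb : (B ⧸ I.map (algebraMap A B)) →ₐ[A ⧸ I] T' :=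
    { Ideal.Quotient.lift _ h.toRingHom hB with
      commutes' := by
        intro r
        obtain ⟨a, rfl⟩ := Ideal.Quotient.mk_surjective r
        exact h.commutes a }
  let p' : T →ₐ[A ⧸ I] T' :=
    { p.toRingHom with
      commutes' := by
        intro r
        obtain ⟨a, rfl⟩ := Ideal.Quotient.mk_surjective r
        exact p.commutes a }
  let l := Algebra.FormallySmooth.liftOfSurjective hb p' hp hnil
  have hl : ∀ x, p' (l x) = hb x := Algebra.FormallySmooth.liftOfSurjective_apply hb p' hp hnil
  refine ⟨{ l.toRingHom.comp (Ideal.Quotient.mk _) with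
      commutes' := fun a => ?_ }, ?_⟩
  · exact l.commutes (Ideal.Quotient.mk I a)
  · ext x
    exact hl (Ideal.Quotient.mk _ x)

lemma exists_lift_completion {A B R : Type*} [CommRing A] [CommRing B] [CommRing R]
    [Algebra A B] [Algebra A R] (m : Ideal A) (n : Ideal R)
    (hmn : m.map (algebraMap A R) ≤ n)
    (hfs : ∀ i : ℕ, (algebraMap (A ⧸ m ^ (i + 1))
      (B ⧸ (m ^ (i + 1)).map (algebraMap A B))).FormallySmooth) (h : B →ₐ[A] R ⧸ n) :
    ∃ g : B →ₐ[A] AdicCompletion n R, ∀ b, AdicCompletion.evalOneₐ n (g b) = h b := by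
  have step : ∀ i (f : B →ₐ[A] R ⧸ n ^ (i + 1)), ∃ f' : B →ₐ[A] R ⧸ n ^ (i + 1 + 1),
      (Ideal.Quotient.factorₐ A (Ideal.pow_le_pow_right (i+1).le_succ)).comp f' = f := by
    intro i f
    refine lift_step (m ^ (i + 1 + 1)) (hfs (i + 1)) ?_ _ ?_ ?_ f
    · rw [IsScalarTower.algebraMap_eq A R, ← Ideal.map_map, Ideal.map_eq_bot_iff_le_ker,
        Ideal.Quotient.algebraMap_eq, Ideal.mk_ker, Ideal.map_pow]
      exact Ideal.pow_right_mono hmn _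
    · exact Ideal.Quotient.factor_surjective (Ideal.pow_le_pow_right (I := n) (i+1).le_succ)
    · refine ⟨2, ?_⟩
      change (RingHom.ker (Ideal.Quotient.factor (Ideal.pow_le_pow_right (I := n) (i+1).le_succ))) ^ 2 = ⊥
      rw [Ideal.Quotient.factor_ker, ← Ideal.map_pow, ← pow_mul,
        Ideal.map_eq_bot_iff_le_ker, Ideal.mk_ker]
      exact Ideal.pow_le_pow_right (by lia)
  choose nxt hnxt using step
  let F : (i : ℕ) → B →ₐ[A] R ⧸ n ^ (i + 1) := fun i => Nat.rec
    ((Ideal.quotientEquivAlgOfEq A (show n = n ^ (0 + 1) by simp)).toAlgHom.comp h)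
    (fun i f => nxt i f) i
  have hF : ∀ i, (Ideal.Quotient.factorₐ A (Ideal.pow_le_pow_right (i+1).le_succ)).comp (F (i + 1))
      = F i := fun i => hnxt i (F i)
  let G : (i : ℕ) → B →ₐ[A] R ⧸ n ^ i := fun i =>
    (Ideal.Quotient.factorₐ A (Ideal.pow_le_pow_right i.le_succ)).comp (F i)
  have hF' : ∀ {i j : ℕ} (hij : i ≤ j),
      (Ideal.Quotient.factorₐ A (Ideal.pow_le_pow_right (by lia : i + 1 ≤ j + 1))).comp (F j)
      = F i := by
    intro i j hij
    induction j, hij using Nat.le_induction with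
    | base => ext x; simp
    | succ j hj ih =>
      rw [← ih, ← hF j]
      ext x
      simp
  have hG : ∀ {i j : ℕ} (hij : i ≤ j),
      (Ideal.Quotient.factorₐ A (Ideal.pow_le_pow_right hij)).comp (G j) = G i := by
    intro i j hij
    simp only [G]
    rw [← hF' hij]
    ext x
    simp
  refine ⟨AdicCompletion.liftAlgHom n G hG, fun b => ?_⟩
  rw [AdicCompletion.evalOneₐ_liftAlgHom]
  have h0 : G 1 = F 0 := by
    rw [← hF 0]
    rfl
  rw [h0]
  simp [F]

end CompIso

namespace CompIso

open Topology in
lemma exists_eval {C D : Type*} [CommRing C] [CommRing D] (n : Ideal D) [IsAdicComplete n D]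
    (N : ℕ) (ψ : C →+* D) (t : Fin N → D) (ht : ∀ i, t i ∈ n) :
    ∃ φ : MvPowerSeries (Fin N) C →+* D, (∀ c, φ (MvPowerSeries.C c) = ψ c) ∧
      (∀ i, φ (MvPowerSeries.X i) = t i) ∧
      ∀ (J : Ideal C), J.map ψ ≤ n → ∀ (k : ℕ) (f : MvPowerSeries (Fin N) C),
        (∀ d, MvPowerSeries.coeff d f ∈ J ^ (k - d.degree)) → φ f ∈ n ^ k := by
  let : WithIdeal D := ⟨n⟩
  let : UniformSpace C := ⊥
  have hD : DiscreteTopology C := ⟨rfl⟩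
  have hadic : IsAdic n := rfl
  have hc := (hadic.isAdicComplete_iff).mp inferInstance
  have := hc.1
  have := hc.2
  have hψ : Continuous ψ := continuous_of_discreteTopology
  have hlin : IsLinearTopology D D := inferInstance
  have hev : MvPowerSeries.HasEval t := by
    refine ⟨fun i => ?_, ?_⟩
    · exact WithIdeal.isTopologicallyNilpotent_of_mem (ht i)
    · rw [Filter.cofinite_eq_bot]; exact Filter.tendsto_bot
  refine ⟨MvPowerSeries.eval₂Hom hψ hev, fun c => ?_, fun i => ?_, ?_⟩
  · rw [MvPowerSeries.coe_eval₂Hom, MvPowerSeries.eval₂_C]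
  · rw [MvPowerSeries.coe_eval₂Hom, MvPowerSeries.eval₂_X]
  · intro J hJ k f hf
    rw [MvPowerSeries.coe_eval₂Hom]
    have hs := MvPowerSeries.hasSum_eval₂ hψ hev f
    have hcl : IsClosed ((n ^ k : Ideal D) : Set D) := by
      have ho : IsOpen ((n ^ k : Ideal D) : Set D) := (isAdic_iff.mp hadic).1 k
      exact AddSubgroup.isClosed_of_isOpen (Submodule.toAddSubgroup (n ^ k)) ho
    refine hcl.mem_of_tendsto hs (Filter.Eventually.of_forall fun s => ?_)
    refine Ideal.sum_mem _ fun d _ => ?_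
    have h1 : ψ (MvPowerSeries.coeff d f) ∈ n ^ (k - d.degree) := by
      refine Ideal.pow_right_mono hJ _ ?_
      rw [← Ideal.map_pow]
      exact Ideal.mem_map_of_mem _ (hf d)
    have h2 : (d.prod fun s e => t s ^ e) ∈ n ^ d.degree := by
      rw [Finsupp.prod, Finsupp.degree_apply, ← Finset.prod_pow_eq_pow_sum]
      exact Ideal.prod_mem_prod fun i _ => Ideal.pow_mem_pow (ht i) _
    have h3 := Ideal.mul_mem_mul h1 h2
    rw [← pow_add] at h3
    exact Ideal.pow_le_pow_right (by lia) h3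

lemma coeff_mul_mem {C : Type*} [CommRing C] (J : Ideal C) {N k l : ℕ}
    (f g : MvPowerSeries (Fin N) C)
    (hf : ∀ d, MvPowerSeries.coeff d f ∈ J ^ (k - d.degree))
    (hg : ∀ d, MvPowerSeries.coeff d g ∈ J ^ (l - d.degree)) :
    ∀ d, MvPowerSeries.coeff d (f * g) ∈ J ^ (k + l - d.degree) := by
  classical
  intro d
  rw [MvPowerSeries.coeff_mul]
  refine Ideal.sum_mem _ fun x hx => ?_
  have h := Ideal.mul_mem_mul (hf x.1) (hg x.2)
  rw [← pow_add] at h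
  refine Ideal.pow_le_pow_right ?_ h
  rw [Finset.HasAntidiagonal.mem_antidiagonal] at hx
  rw [← hx, map_add]
  lia

lemma surj {C D : Type*} [CommRing C] [CommRing D] (J : Ideal C) [IsPrecomplete J C]
    (n : Ideal D) [IsHausdorff n D] (N : ℕ) (ψ : C →+* D) (t : Fin N → D)
    (hn : n = J.map ψ ⊔ Ideal.span (Set.range t))
    (hψ : ∀ d : D, ∃ c, d - ψ c ∈ n)
    (φ : MvPowerSeries (Fin N) C →+* D) (hC : ∀ c, φ (MvPowerSeries.C c) = ψ c)
    (hX : ∀ i, φ (MvPowerSeries.X i) = t i)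
    (hφ : ∀ (k : ℕ) (f : MvPowerSeries (Fin N) C),
        (∀ d, MvPowerSeries.coeff d f ∈ J ^ (k - d.degree)) → φ f ∈ n ^ k) :
    Function.Surjective φ := by
  classical
  -- degree one approximation
  have h1 : ∀ x ∈ n, ∃ f : MvPowerSeries (Fin N) C,
      (∀ d, MvPowerSeries.coeff d f ∈ J ^ (1 - d.degree)) ∧ x - φ f ∈ n ^ 2 := by
    have hn' : n = Ideal.span (ψ '' J ∪ Set.range t) := by
      rw [Ideal.span_union, ← hn.symm]; rfl
    have key : ∀ (y : D) (F : MvPowerSeries (Fin N) C), y = φ F →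
        (∀ d, MvPowerSeries.coeff d F ∈ J ^ (1 - d.degree)) → ∀ z : D,
        ∃ f : MvPowerSeries (Fin N) C,
      (∀ d, MvPowerSeries.coeff d f ∈ J ^ (1 - d.degree)) ∧ z * y - φ f ∈ n ^ 2 := by
      intro y F hy hF z
      obtain ⟨c, hc⟩ := hψ z
      refine ⟨MvPowerSeries.C c * F, fun d => ?_, ?_⟩
      · rw [MvPowerSeries.coeff_C_mul]
        exact Ideal.mul_mem_left _ _ (hF d)
      · rw [map_mul, hC, ← hy, ← sub_mul, pow_two]
        have := hφ 1 F hF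
        rw [pow_one, ← hy] at this
        exact Ideal.mul_mem_mul hc this
    intro x hx
    rw [hn'] at hx
    induction hx using Submodule.span_induction with
    | mem x hx =>
      rcases hx with ⟨c, hc, rfl⟩ | ⟨i, rfl⟩
      · refine ⟨MvPowerSeries.C c, fun d => ?_, by simp [hC]⟩
        rw [MvPowerSeries.coeff_C]
        split_ifs with h
        · subst h; simpa using hc
        · simp
      · refine ⟨MvPowerSeries.X i, fun d => ?_, by simp [hX]⟩
        rw [MvPowerSeries.coeff_X]
        split_ifs with h
        · subst h; simp
        · simp
    | zero => exact ⟨0, by simp, by simp⟩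
    | add x y _ _ hx hy =>
      obtain ⟨f, hf, hf'⟩ := hx
      obtain ⟨g, hg, hg'⟩ := hy
      refine ⟨f + g, fun d => ?_, ?_⟩
      · rw [map_add]; exact add_mem (hf d) (hg d)
      · rw [map_add, add_sub_add_comm]; exact add_mem hf' hg'
    | smul z y _ hy =>
      obtain ⟨f, hf, hf'⟩ := hy
      obtain ⟨g, hg, hg'⟩ := key _ f rfl hf z
      refine ⟨g, hg, ?_⟩
      have : z • y - φ g = z * (y - φ f) + (z * φ f - φ g) := by rw [smul_eq_mul]; ring
      rw [this]
      exact add_mem (Ideal.mul_mem_left _ _ hf') hg'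
  have hk : ∀ k : ℕ, ∀ x ∈ n ^ k, ∃ f : MvPowerSeries (Fin N) C,
      (∀ d, MvPowerSeries.coeff d f ∈ J ^ (k - d.degree)) ∧ x - φ f ∈ n ^ (k + 1) := by
    intro k
    induction k with
    | zero =>
      intro x _
      obtain ⟨c, hc⟩ := hψ x
      exact ⟨MvPowerSeries.C c, by simp, by simpa [hC] using hc⟩
    | succ k ih =>
      intro x hx
      rw [pow_succ] at hx
      induction hx using Submodule.mul_induction_on' with
      | mem_mul_mem a ha b hb =>
        obtain ⟨f, hf, hf'⟩ := ih a ha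
        obtain ⟨g, hg, hg'⟩ := h1 b hb
        refine ⟨f * g, coeff_mul_mem J f g hf hg, ?_⟩
        have : a * b - φ (f * g) = (a - φ f) * b + φ f * (b - φ g) := by rw [map_mul]; ring
        rw [this]
        refine add_mem ?_ ?_
        · rw [pow_succ]; exact Ideal.mul_mem_mul hf' hb
        · have := Ideal.mul_mem_mul (hφ k f hf) hg'
          rwa [← pow_add] at this
      | add x _ y _ hx hy =>
        obtain ⟨f, hf, hf'⟩ := hx
        obtain ⟨g, hg, hg'⟩ := hy
        refine ⟨f + g, fun d => ?_, ?_⟩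
        · rw [map_add]; exact add_mem (hf d) (hg d)
        · rw [map_add, add_sub_add_comm]; exact add_mem hf' hg'
  intro x
  choose! P hP hP' using hk
  -- successive remainders
  let r : ℕ → D := fun k => Nat.rec x (fun k y => y - φ (P k y)) k
  have hr0 : r 0 = x := rfl
  have hrs : ∀ k, r (k + 1) = r k - φ (P k (r k)) := fun k => rfl
  have hr : ∀ k, r k ∈ n ^ k := by
    intro k
    induction k with
    | zero => simp
    | succ k ih => rw [hrs]; exact hP' k _ ih
  let p : ℕ → MvPowerSeries (Fin N) C := fun k => P k (r k)
  have hp : ∀ k d, MvPowerSeries.coeff d (p k) ∈ J ^ (k - d.degree) := fun k => hP k _ (hr k)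
  have hsum : ∀ k, x - φ (∑ i ∈ Finset.range k, p i) = r k := by
    intro k
    induction k with
    | zero => simp [hr0]
    | succ k ih => rw [Finset.sum_range_succ, map_add, ← sub_sub, ih, hrs]
  have hlim : ∀ d : Fin N →₀ ℕ, ∃ c : C, ∀ k,
      (∑ i ∈ Finset.range (k + d.degree), MvPowerSeries.coeff d (p i)) - c ∈ J ^ k := by
    intro d
    obtain ⟨L, hL⟩ := IsPrecomplete.prec (I := J) inferInstance
      (f := fun k => ∑ i ∈ Finset.range (k + d.degree), MvPowerSeries.coeff d (p i)) (by
        intro a b hab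
        rw [SModEq.sub_mem, ← neg_mem_iff, neg_sub, smul_eq_mul, Ideal.mul_top,
          ← Finset.sum_Ico_eq_sub _ (by lia)]
        refine Ideal.sum_mem _ fun i hi => ?_
        rw [Finset.mem_Ico] at hi
        exact Ideal.pow_le_pow_right (by lia) (hp i d))
    refine ⟨L, fun k => ?_⟩
    have := hL k
    rwa [SModEq.sub_mem, smul_eq_mul, Ideal.mul_top] at this
  choose c hc using hlim
  let f : MvPowerSeries (Fin N) C := fun d => c d
  have hf : ∀ d, MvPowerSeries.coeff d f = c d := fun d => rfl
  refine ⟨f, ?_⟩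
  rw [← sub_eq_zero]
  refine IsHausdorff.haus (I := n) inferInstance _ fun k => ?_
  rw [SModEq.zero, smul_eq_mul, Ideal.mul_top]
  have h2 : φ (f - ∑ i ∈ Finset.range k, p i) ∈ n ^ k := by
    refine hφ k _ fun d => ?_
    by_cases hd : d.degree ≤ k
    · have := hc d (k - d.degree)
      rw [Nat.sub_add_cancel hd] at this
      rw [map_sub, map_sum, hf, ← neg_mem_iff, neg_sub]
      exact this
    · simp [Nat.sub_eq_zero_of_le (le_of_not_ge hd)]
  have h3 := sub_mem h2 (hr k)
  rw [← hsum k, map_sub] at h3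
  convert h3 using 1
  ring

end CompIso

namespace CompIso

lemma dim_powerSeries {S : Type*} [CommRing S] [IsNoetherianRing S] [IsLocalRing S] :
    ringKrullDim (PowerSeries S) = ringKrullDim S + 1 := by
  have hs : Function.Surjective (PowerSeries.constantCoeff (R := S)) := fun x => ⟨PowerSeries.C x, rfl⟩
  have hker : RingHom.ker (PowerSeries.constantCoeff (R := S)) =
      Ideal.span {(PowerSeries.X : PowerSeries S)} := by
    ext f
    rw [RingHom.mem_ker, Ideal.mem_span_singleton, PowerSeries.X_dvd_iff]
  have h := ringKrullDim_quotient_span_singleton_succ_eq_ringKrullDim_of_mem_nonZeroDivisors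
    (x := (PowerSeries.X : PowerSeries S)) MvPowerSeries.X_mem_nonzeroDivisors (by
      rw [mem_maximalIdeal, mem_nonunits_iff, PowerSeries.isUnit_iff_constantCoeff]
      simp)
  rw [← h, ← ringKrullDim_eq_of_ringEquiv (RingHom.quotientKerEquivOfSurjective hs), hker]

lemma dim_mvPowerSeries (K : Type*) [Field K] (N : ℕ) :
    ringKrullDim (MvPowerSeries (Fin N) K) = N := by
  induction N with
  | zero =>
    rw [ringKrullDim_eq_of_ringEquiv (MvPowerSeries.isEmptyEquiv (σ := Fin 0) (R := K)).toRingEquiv]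
    simp
  | succ N ih =>
    rw [ringKrullDim_eq_of_ringEquiv (MvPowerSeries.finSuccEquiv K N).toRingEquiv,
      dim_powerSeries, ih]
    simp

lemma mem_ker_map {C : Type*} [CommRing C] (J : Ideal C) {N : ℕ} (f : MvPowerSeries (Fin N) C) :
    f ∈ RingHom.ker (MvPowerSeries.map (σ := Fin N) (Ideal.Quotient.mk J)) ↔
      ∀ d, MvPowerSeries.coeff d f ∈ J := by
  rw [RingHom.mem_ker, MvPowerSeries.ext_iff]
  simp [Ideal.Quotient.eq_zero_iff_mem]

lemma mem_map_of_coeff {C : Type*} [CommRing C] (J : Ideal C) (hJ : J.FG) {N : ℕ}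
    (f : MvPowerSeries (Fin N) C) (hf : ∀ d, MvPowerSeries.coeff d f ∈ J) :
    f ∈ J.map (MvPowerSeries.C (σ := Fin N)) := by
  obtain ⟨s, rfl⟩ := hJ
  have h : ∀ d, ∃ g : C → C, ∑ i ∈ s, g i * i = MvPowerSeries.coeff d f := by
    intro d
    obtain ⟨g, -, hg⟩ := (Submodule.mem_span_finset).mp (hf d)
    exact ⟨g, hg⟩
  choose g hg using h
  have : f = ∑ i ∈ s, (show MvPowerSeries (Fin N) C from fun d => g d i) * MvPowerSeries.C i := by
    ext d
    rw [map_sum, ← hg]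
    refine Finset.sum_congr rfl fun i _ => ?_
    rw [MvPowerSeries.coeff_mul_C]
    rfl
  rw [this]
  exact Ideal.sum_mem _ fun i hi => Ideal.mul_mem_left _ _
    (Ideal.mem_map_of_mem _ (Ideal.subset_span hi))

lemma inj {A C D : Type*} [CommRing A] [CommRing C] [CommRing D] [IsNoetherianRing A]
    [Algebra A C] [Algebra A D] [Module.Flat A D] (m : Ideal A) (J : Ideal C)
    (hJ : m.map (algebraMap A C) = J) [J.IsMaximal] [IsHausdorff J C] (N : ℕ)
    (φ : MvPowerSeries (Fin N) C →+* D)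
    (hφA : ∀ a, φ (MvPowerSeries.C (algebraMap A C a)) = algebraMap A D a)
    (hφ : Function.Surjective φ)
    (hdim : (N : WithBot ℕ∞) ≤ ringKrullDim (D ⧸ m.map (algebraMap A D))) :
    Function.Injective φ := by
  have hAP : ∀ a, algebraMap A (MvPowerSeries (Fin N) C) a = MvPowerSeries.C (algebraMap A C a) :=
    fun a => MvPowerSeries.algebraMap_apply
  have hAP' : algebraMap A (MvPowerSeries (Fin N) C) = MvPowerSeries.C.comp (algebraMap A C) :=
    RingHom.ext hAP
  let φA : MvPowerSeries (Fin N) C →ₐ[A] D := { φ with commutes' := fun a => (congrArg φ (hAP a)).trans (hφA a) }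
  have hpow : ∀ k, (m ^ k).map (algebraMap A (MvPowerSeries (Fin N) C)) ≤
      RingHom.ker (MvPowerSeries.map (σ := Fin N) (Ideal.Quotient.mk (J ^ k))) := by
    intro k
    rw [Ideal.map_le_iff_le_comap]
    intro a ha
    have h1 : algebraMap A C a ∈ J ^ k := by
      rw [← hJ, ← Ideal.map_pow]; exact Ideal.mem_map_of_mem _ ha
    rw [Ideal.mem_comap, RingHom.mem_ker, hAP, MvPowerSeries.map_C,
      Ideal.Quotient.eq_zero_iff_mem.mpr h1, map_zero]
  have hfg : J.FG := by
    rw [← hJ]; exact Ideal.FG.map (IsNoetherian.noetherian m) _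
  let π : MvPowerSeries (Fin N) C →+* MvPowerSeries (Fin N) (C ⧸ J) :=
    MvPowerSeries.map (Ideal.Quotient.mk J)
  have hπ : Function.Surjective π := by
    intro f
    choose g hg using fun d => Ideal.Quotient.mk_surjective (I := J) (MvPowerSeries.coeff d f)
    refine ⟨show MvPowerSeries (Fin N) C from g, ?_⟩
    ext d
    exact hg d
  have hkerπ : RingHom.ker π = m.map (algebraMap A (MvPowerSeries (Fin N) C)) := by
    apply le_antisymm
    · intro f hf
      have := mem_map_of_coeff J hfg f ((mem_ker_map J f).mp hf)
      rwa [← hJ, Ideal.map_map, ← hAP'] at this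
    · have := hpow 1
      rwa [pow_one, pow_one] at this
  have hsub : RingHom.ker φ ≤ m.map (algebraMap A (MvPowerSeries (Fin N) C)) := by
    rw [← hkerπ]
    intro x hx
    by_contra hx'
    let : Field (C ⧸ J) := Ideal.Quotient.field J
    let q : MvPowerSeries (Fin N) C →+* D ⧸ m.map (algebraMap A D) :=
      (Ideal.Quotient.mk _).comp φ
    have hq : RingHom.ker π ≤ RingHom.ker q := by
      rw [hkerπ, Ideal.map_le_iff_le_comap]
      intro a ha
      rw [Ideal.mem_comap, RingHom.mem_ker]
      change Ideal.Quotient.mk _ (φ _) = 0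
      rw [hAP, hφA, Ideal.Quotient.eq_zero_iff_mem]
      exact Ideal.mem_map_of_mem _ ha
    let ρ := RingHom.liftOfSurjective π hπ ⟨q, hq⟩
    have hρ : ∀ y, ρ (π y) = q y := fun y => RingHom.liftOfRightInverse_comp_apply _ _ _ _ y
    have hρs : Function.Surjective ρ := by
      intro z
      obtain ⟨w, rfl⟩ := Ideal.Quotient.mk_surjective z
      obtain ⟨y, rfl⟩ := hφ w
      exact ⟨π y, hρ y⟩
    have h := ringKrullDim_succ_le_of_surjective ρ hρs (r := π x)
      (mem_nonZeroDivisors_of_ne_zero hx') (by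
        rw [hρ]; change Ideal.Quotient.mk _ (φ x) = 0
        rw [(RingHom.mem_ker).mp hx, map_zero])
    rw [dim_mvPowerSeries] at h
    have h2 := (add_le_add_left hdim 1).trans h
    have h3 : N + 1 ≤ N := by exact_mod_cast h2
    lia
  have hflat := LinearMap.ker_inf_smul_top_eq_smul_of_flat m φA.toLinearMap hφ
  have hN : LinearMap.ker φA.toLinearMap = m • LinearMap.ker φA.toLinearMap := by
    rw [← hflat, eq_comm, inf_eq_left, Ideal.smul_top_eq_map]
    exact hsub
  have hNk : ∀ k : ℕ, LinearMap.ker φA.toLinearMap ≤ m ^ k • ⊤ := by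
    intro k
    have : LinearMap.ker φA.toLinearMap = m ^ k • LinearMap.ker φA.toLinearMap := by
      induction k with
      | zero => simp
      | succ k ih => rw [pow_succ, Submodule.mul_smul, ← hN, ← ih]
    rw [this]
    exact smul_mono_right _ le_top
  rw [injective_iff_map_eq_zero]
  intro x hx
  ext d
  rw [map_zero]
  refine IsHausdorff.haus (I := J) inferInstance _ fun k => ?_
  rw [SModEq.zero, smul_eq_mul, Ideal.mul_top]
  have h1 : x ∈ m ^ k • (⊤ : Submodule A (MvPowerSeries (Fin N) C)) := hNk k hx
  rw [Ideal.smul_top_eq_map] at h1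
  exact (mem_ker_map _ _).mp (hpow k h1) d

lemma dim_ge {A R : Type*} [CommRing A] [CommRing R] [IsLocalRing A] [IsLocalRing R]
    [Algebra A R] [Module.Flat A R] [IsLocalHom (algebraMap A R)] :
    ringKrullDim A ≤ ringKrullDim R := by
  have := Module.FaithfullyFlat.of_flat_of_isLocalHom (A := A) (B := R)
  refine iSup_le fun l => ?_
  obtain ⟨P, hP⟩ := PrimeSpectrum.comap_surjective_of_faithfullyFlat (A := A) (B := R) l.last
  have : P.asIdeal.LiesOver l.last.asIdeal := ⟨by rw [← hP]; rfl⟩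
  obtain ⟨L, hL, -⟩ := Ideal.exists_ltSeries_of_hasGoingDown l P.asIdeal
  rw [← hL]
  exact Order.LTSeries.length_le_krullDim L

end CompIso

namespace CompIso

lemma exists_ext {B D : Type*} [CommRing B] [CommRing D] (J : Ideal B) (n : Ideal D)
    [IsAdicComplete n D] (g : B →+* D) (hg : J.map g ≤ n) :
    ∃ ψ : AdicCompletion J B →+* D, ∀ b, ψ (algebraMap B _ b) = g b := by
  have hle : ∀ i, J ^ i ≤ (n ^ i).comap g := fun i => by
    rw [← Ideal.map_le_iff_le_comap, Ideal.map_pow]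
    exact Ideal.pow_right_mono hg i
  let f : (i : ℕ) → AdicCompletion J B →+* D ⧸ n ^ i := fun i =>
    (Ideal.quotientMap (n ^ i) g (hle i)).comp (AdicCompletion.evalₐ J i : _ →+* _)
  have hf : ∀ {i j : ℕ} (hij : i ≤ j), (Ideal.Quotient.factorPow n hij).comp (f j) = f i := by
    intro i j hij
    ext x
    obtain ⟨y, rfl⟩ := AdicCompletion.mk_surjective J B x
    simp only [f, RingHom.comp_apply, RingHom.coe_coe, AdicCompletion.evalₐ_mk,
      Ideal.quotientMap_mk]
    change Ideal.Quotient.mk (n ^ i) (g (y.val j)) = Ideal.Quotient.mk (n ^ i) (g (y.val i))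
    rw [Ideal.Quotient.eq, ← map_sub]
    have h := (y.property hij).symm
    rw [SModEq.sub_mem, smul_eq_mul, Ideal.mul_top] at h
    exact hle i h
  refine ⟨IsAdicComplete.liftRingHom n f hf, fun b => ?_⟩
  rw [← sub_eq_zero]
  refine IsHausdorff.haus (I := n) inferInstance _ fun k => ?_
  rw [SModEq.zero, smul_eq_mul, Ideal.mul_top, ← Ideal.Quotient.eq_zero_iff_mem, map_sub,
    IsAdicComplete.mk_liftRingHom, sub_eq_zero]
  simp [f]

lemma exists_params {A R T : Type*} [CommRing A] [CommRing R] [CommRing T] [IsLocalRing R]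
    [IsLocalRing T] (f : R →+* T) (hf : Function.Surjective f) (n : ℕ) (s : Finset T)
    (hs : Ideal.span (s : Set T) = maximalIdeal T) (hc : s.card = n) :
    ∃ t : Fin n → R, maximalIdeal R = RingHom.ker f ⊔ Ideal.span (Set.range t) := by
  let e := s.equivFinOfCardEq hc
  choose t ht using fun i : Fin n => hf ((e.symm i : s) : T)
  refine ⟨t, ?_⟩
  have h1 : ((maximalIdeal T).comap f).IsMaximal := Ideal.comap_isMaximal_of_surjective f hf
  rw [← eq_maximalIdeal h1, ← hs]
  have h2 : (s : Set T) = f '' Set.range t := by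
    ext x
    simp only [Finset.mem_coe, Set.mem_image, Set.mem_range, exists_exists_eq_and, ht]
    constructor
    · intro hx
      exact ⟨e ⟨x, hx⟩, by simp⟩
    · rintro ⟨i, rfl⟩
      exact (e.symm i).2
  rw [h2, ← Ideal.map_span, Ideal.comap_map_of_surjective f hf, sup_comm]
  rfl

lemma dim_quot {R S : Type*} [CommRing R] [CommRing S] [IsLocalRing R] [IsLocalRing S]
    [Algebra R S] [Module.Flat R S] [IsLocalHom (algebraMap R S)] (I : Ideal R) (hI : I ≠ ⊤) :
    ringKrullDim (R ⧸ I) ≤ ringKrullDim (S ⧸ I.map (algebraMap R S)) := by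
  have h1 : I.map (algebraMap R S) ≠ ⊤ := by
    intro h
    have : I.map (algebraMap R S) ≤ maximalIdeal S :=
      (Ideal.map_mono (le_maximalIdeal hI)).trans
        (((IsLocalRing.local_hom_TFAE (algebraMap R S)).out 0 2).mp ‹IsLocalHom (algebraMap R S)›)
    rw [h] at this
    exact (maximalIdeal.isMaximal S).ne_top (top_le_iff.mp this)
  have : Nontrivial (R ⧸ I) := Ideal.Quotient.nontrivial_iff.mpr hI
  have : Nontrivial (S ⧸ I.map (algebraMap R S)) := Ideal.Quotient.nontrivial_iff.mpr h1
  have : IsLocalRing (R ⧸ I) := IsLocalRing.of_surjective' _ Ideal.Quotient.mk_surjective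
  have : IsLocalRing (S ⧸ I.map (algebraMap R S)) :=
    IsLocalRing.of_surjective' _ Ideal.Quotient.mk_surjective
  have : Module.Flat (R ⧸ I) (S ⧸ I.map (algebraMap R S)) :=
    RingHom.flat_algebraMap_iff.mp (flat_quot I)
  have : IsLocalHom (Ideal.Quotient.mk (I.map (algebraMap R S))) :=
    IsLocalHom.of_surjective _ Ideal.Quotient.mk_surjective
  have : IsLocalHom (algebraMap (R ⧸ I) (S ⧸ I.map (algebraMap R S))) := by
    refine ⟨fun x hx => ?_⟩
    obtain ⟨r, rfl⟩ := Ideal.Quotient.mk_surjective x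
    have h2 : IsUnit (Ideal.Quotient.mk (I.map (algebraMap R S)) (algebraMap R S r)) := hx
    exact (isUnit_of_map_unit (algebraMap R S) _ (isUnit_of_map_unit _ _ h2)).map _
  exact dim_ge

theorem core
    (A R B : Type*) [CommRing A] [CommRing R] [CommRing B]
    [IsLocalRing A] [IsLocalRing R] [IsLocalRing B]
    [IsNoetherianRing A] [IsNoetherianRing R] [IsNoetherianRing B]
    [Algebra A R] [IsLocalHom (algebraMap A R)] [Module.Flat A R]
    [Algebra A B] [IsLocalHom (algebraMap A B)] [Module.Flat A B]
    (hfs : (ResidueField.map (algebraMap A R)).FormallySmooth)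
    (n : ℕ)
    (hreg : IsRegularLocalOfDim (TensorProduct A (ResidueField A) R) n)
    (hJ : (maximalIdeal A).map (algebraMap A B) = maximalIdeal B)
    (e : ResidueField B ≃+* ResidueField R)
    (he : (e : ResidueField B →+* ResidueField R).comp (ResidueField.map (algebraMap A B)) =
        ResidueField.map (algebraMap A R)) :
    ∃ φ : MvPowerSeries (Fin n) (AdicCompletion (maximalIdeal B) B) ≃+*
        AdicCompletion (maximalIdeal R) R,
      ∀ a, φ (MvPowerSeries.C (algebraMap B _ (algebraMap A B a))) =
        algebraMap R _ (algebraMap A R a) := by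
  let q : B →+* ResidueField R := (e : ResidueField B →+* ResidueField R).comp (residue B)
  have hq : Function.Surjective q := e.surjective.comp residue_surjective
  have hqA : q.comp (algebraMap A B) = (ResidueField.map (algebraMap A R)).comp (residue A) := by
    rw [← he]; rfl
  have hkerq : RingHom.ker q = (maximalIdeal A).map (algebraMap A B) := by
    rw [hJ, ← ker_residue]
    ext x
    simp [q, RingHom.mem_ker]
  have hmn : (maximalIdeal A).map (algebraMap A R) ≤ maximalIdeal R :=
    ((IsLocalRing.local_hom_TFAE (algebraMap A R)).out 0 2).mp ‹IsLocalHom (algebraMap A R)›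
  let h : B →ₐ[A] R ⧸ maximalIdeal R :=
    { q with commutes' := fun a => congr($hqA a) }
  obtain ⟨g, hg⟩ := exists_lift_completion (maximalIdeal A) (maximalIdeal R) hmn
    (fs_quot _ hfs q hq hkerq hqA) h
  have hnhat := AdicCompletion.maximalIdeal_eq_map (R := R)
  have hmem : ∀ x : AdicCompletion (maximalIdeal R) R,
      x ∈ maximalIdeal (AdicCompletion (maximalIdeal R) R) ↔
        AdicCompletion.evalOneₐ (maximalIdeal R) x = 0 := by
    intro x
    rw [hnhat, ← AdicCompletion.ker_evalOneₐ_eq_map _ (maximalIdeal R).fg_of_isNoetherianRing]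
    rfl
  have hgn : (maximalIdeal B).map g.toRingHom ≤
      maximalIdeal (AdicCompletion (maximalIdeal R) R) := by
    rw [Ideal.map_le_iff_le_comap]
    intro b hb
    rw [← hJ, ← hkerq] at hb
    exact (hmem _).mpr ((hg b).trans hb)
  obtain ⟨ψ, hψ⟩ := exists_ext (maximalIdeal B) _ g.toRingHom hgn
  have hψA : ∀ a, ψ (algebraMap B _ (algebraMap A B a)) = algebraMap R _ (algebraMap A R a) := by
    intro a
    rw [hψ]
    refine (g.commutes a).trans ?_
    exact IsScalarTower.algebraMap_apply A R _ a
  -- parameters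
  obtain ⟨-, hloc, s, hs, hcard, hdim⟩ := hreg
  let E : (R ⧸ (maximalIdeal A).map (algebraMap A R)) ≃+* TensorProduct A (ResidueField A) R :=
    (Algebra.TensorProduct.quotIdealMapEquivQuotTensor R (maximalIdeal A)).toRingEquiv
  let f : R →+* TensorProduct A (ResidueField A) R :=
    E.toRingHom.comp (Ideal.Quotient.mk _)
  have hf : Function.Surjective f := E.surjective.comp Ideal.Quotient.mk_surjective
  have hkerf : RingHom.ker f = (maximalIdeal A).map (algebraMap A R) := by
    ext x
    simp [f, RingHom.mem_ker, Ideal.Quotient.eq_zero_iff_mem]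
  obtain ⟨t, ht⟩ := exists_params (A := A) f hf n s hs hcard
  rw [hkerf] at ht
  have hdim' : (n : WithBot ℕ∞) ≤
      ringKrullDim (R ⧸ (maximalIdeal A).map (algebraMap A R)) := by
    rw [ringKrullDim_eq_of_ringEquiv E, hdim]
  let t' : Fin n → AdicCompletion (maximalIdeal R) R := fun i => algebraMap R _ (t i)
  have hJhat := AdicCompletion.maximalIdeal_eq_map (R := B)
  have hcompA : algebraMap A (AdicCompletion (maximalIdeal R) R) =
      (algebraMap R _).comp (algebraMap A R) := IsScalarTower.algebraMap_eq A R _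
  have hJA : (maximalIdeal A).map (algebraMap A (AdicCompletion (maximalIdeal B) B)) =
      maximalIdeal (AdicCompletion (maximalIdeal B) B) := by
    rw [hJhat, ← hJ, Ideal.map_map, ← IsScalarTower.algebraMap_eq]
  have hJψ : (maximalIdeal (AdicCompletion (maximalIdeal B) B)).map ψ =
      ((maximalIdeal A).map (algebraMap A R)).map (algebraMap R _) := by
    rw [← hJA, Ideal.map_map, Ideal.map_map]
    congr 1
    refine RingHom.ext fun a => ?_
    rw [RingHom.comp_apply, IsScalarTower.algebraMap_apply A B]
    exact hψA a
  have hn' : maximalIdeal (AdicCompletion (maximalIdeal R) R) =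
      (maximalIdeal (AdicCompletion (maximalIdeal B) B)).map ψ ⊔ Ideal.span (Set.range t') := by
    rw [hJψ, hnhat]
    refine (congrArg (Ideal.map (algebraMap R (AdicCompletion (maximalIdeal R) R))) ht).trans ?_
    rw [Ideal.map_sup, Ideal.map_span, ← Set.range_comp]
    rfl
  have ht' : ∀ i, t' i ∈ maximalIdeal (AdicCompletion (maximalIdeal R) R) := by
    intro i
    rw [hn']
    exact Ideal.mem_sup_right (Ideal.subset_span ⟨i, rfl⟩)
  obtain ⟨φ, hC, hX, hφ⟩ := exists_eval (maximalIdeal (AdicCompletion (maximalIdeal R) R))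
    n ψ t' ht'
  have hφ' := hφ (maximalIdeal (AdicCompletion (maximalIdeal B) B)) (by rw [hn']; exact le_sup_left)
  have hψs : ∀ d : AdicCompletion (maximalIdeal R) R, ∃ c, d - ψ c ∈
      maximalIdeal (AdicCompletion (maximalIdeal R) R) := by
    intro d
    obtain ⟨b, hb⟩ := hq (AdicCompletion.evalOneₐ (maximalIdeal R) d)
    refine ⟨algebraMap B _ b, ?_⟩
    rw [hmem, map_sub, sub_eq_zero, hψ]
    exact hb.symm.trans (hg b).symm
  have hsurj := surj _ _ n ψ t' hn' hψs φ hC hX hφ'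
  have hflat0 : Module.Flat R (AdicCompletion (maximalIdeal R) R) :=
    AdicCompletion.flat_of_isNoetherian _
  have hflat : Module.Flat A (AdicCompletion (maximalIdeal R) R) := Module.Flat.trans A R _
  have hinj := inj (D := AdicCompletion (maximalIdeal R) R) (maximalIdeal A) _ hJA n φ
    (fun a => by
      rw [hC, hcompA, IsScalarTower.algebraMap_apply A B]
      exact hψA a) hsurj (by
      rw [hcompA, ← Ideal.map_map]
      exact hdim'.trans (dim_quot _
        (ne_top_of_le_ne_top (maximalIdeal.isMaximal R).ne_top hmn)))
  exact ⟨RingEquiv.ofBijective φ ⟨hinj, hsurj⟩, fun a => (hC _).trans (hψA a)⟩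

end CompIso

/-- Let `(A,m) → (R,n)` be a flat local homomorphism of Noetherian local
rings with `k(n)` separable over `k(m)` and `R ⊗_A k(m)` regular of dimension `n ≥ 1`.
Let `(B,J)` be a Noetherian local ring with a flat local homomorphism `A → B` such that
`mB = J` and `k(J) ≅ k(n)` over `k(m)`. Then `R̂ ≅ B̂[[T₁,…,Tₙ]]` as `A`-algebras, where
`R̂` is the `n`-adic completion of `R` and `B̂` the `J`-adic completion of `B`. -/
theorem completion_iso_powerSeries_over_coefficient_field
    (A R B : Type*) [CommRing A] [CommRing R] [CommRing B]
    [IsLocalRing A] [IsLocalRing R] [IsLocalRing B]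
    [IsNoetherianRing A] [IsNoetherianRing R] [IsNoetherianRing B]
    [Algebra A R] [IsLocalHom (algebraMap A R)] [Module.Flat A R]
    [Algebra A B] [IsLocalHom (algebraMap A B)] [Module.Flat A B]
    (hsep : letI : Algebra (ResidueField A) (ResidueField R) :=
        (ResidueField.map (algebraMap A R)).toAlgebra
      Algebra.IsSeparable (ResidueField A) (ResidueField R))
    (n : ℕ) (hn : 1 ≤ n)
    (hreg : IsRegularLocalOfDim (TensorProduct A (ResidueField A) R) n)
    (hJ : (maximalIdeal A).map (algebraMap A B) = maximalIdeal B)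
    (hresB : ∃ e : ResidueField B ≃+* ResidueField R,
      (e : ResidueField B →+* ResidueField R).comp (ResidueField.map (algebraMap A B)) =
        ResidueField.map (algebraMap A R)) :
    letI : Algebra A (AdicCompletion (maximalIdeal R) R) :=
      ((algebraMap R (AdicCompletion (maximalIdeal R) R)).comp (algebraMap A R)).toAlgebra
    letI : Algebra A (AdicCompletion (maximalIdeal B) B) :=
      ((algebraMap B (AdicCompletion (maximalIdeal B) B)).comp (algebraMap A B)).toAlgebra
    Nonempty (AdicCompletion (maximalIdeal R) R ≃ₐ[A]
      MvPowerSeries (Fin n) (AdicCompletion (maximalIdeal B) B)) := by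
  obtain ⟨e, he⟩ := hresB
  have hfs : (ResidueField.map (algebraMap A R)).FormallySmooth := by
    let : Algebra (ResidueField A) (ResidueField R) :=
      (ResidueField.map (algebraMap A R)).toAlgebra
    have : Algebra.IsSeparable (ResidueField A) (ResidueField R) := hsep
    have : Algebra.FormallyEtale (ResidueField A) (ResidueField R) :=
      Algebra.FormallyEtale.of_isSeparable _ _
    have : (algebraMap (ResidueField A) (ResidueField R)).FormallySmooth :=
      RingHom.formallySmooth_algebraMap.mpr inferInstance
    exact this
  obtain ⟨φ, hφ⟩ := CompIso.core A R B hfs n hreg hJ e he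
  let i1 : Algebra A (AdicCompletion (maximalIdeal R) R) :=
    ((algebraMap R (AdicCompletion (maximalIdeal R) R)).comp (algebraMap A R)).toAlgebra
  let i2 : Algebra A (AdicCompletion (maximalIdeal B) B) :=
    ((algebraMap B (AdicCompletion (maximalIdeal B) B)).comp (algebraMap A B)).toAlgebra
  refine ⟨AlgEquiv.symm { φ with commutes' := fun a => ?_ }⟩
  exact (congrArg φ MvPowerSeries.algebraMap_apply).trans (hφ a)
end

section
/- Let (A,m) → (R,n) be a flat local homomorphism of Noetherian local rings with k(n) separable over k(m) and R ⊗_A k(m) regular. Let I ⊊ R be a proper ideal such that (a) no prime ideal in the preimage of V(I) under Spec R → Spec A is contained in an associated prime of A, and (b) I ⊄ mR. Then depth(I,R) ≥ 2. -/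
open RingTheory.Sequence IsLocalRing

/-- The depth of an ideal `I` on a Noetherian ring `R`: the supremum of the lengths of
`R`-regular sequences contained in `I`. -/
noncomputable def idealDepth (R : Type*) [CommRing R] (I : Ideal R) : ℕ∞ :=
  sSup {n : ℕ∞ | ∃ rs : List R, (∀ r ∈ rs, r ∈ I) ∧ IsRegular R rs ∧ (rs.length : ℕ∞) = n}

lemma aux_dim_le (n : ℕ) (T : Type*) [CommRing T] [IsLocalRing T] [IsNoetherianRing T]
    (l : List T) (hl : l.length = n) (hm : Ideal.ofList l = maximalIdeal T) :
    ringKrullDim T ≤ n := by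
  classical
  refine (ringKrullDim_le_spanFinrank_maximalIdeal T).trans ?_
  rw [← hm]
  have h1 : {r | r ∈ l} = ((l.toFinset : Finset T) : Set T) := by ext; simp
  have h2 : (Ideal.ofList l).spanFinrank ≤ n := by
    unfold Ideal.ofList
    rw [h1]
    refine (Submodule.spanFinrank_span_le_ncard_of_finite (Finset.finite_toSet _)).trans ?_
    rw [Set.ncard_coe_finset, ← hl]
    exact List.toFinset_card_le l
  exact_mod_cast h2

lemma aux_quot_max (T : Type*) [CommRing T] [IsLocalRing T] (J K : Ideal T)
    [IsLocalRing (T ⧸ J)] (h : J ⊔ K = maximalIdeal T) :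
    K.map (Ideal.Quotient.mk J) = maximalIdeal (T ⧸ J) := by
  have h1 : (maximalIdeal T).map (Ideal.Quotient.mk J) = maximalIdeal (T ⧸ J) := by
    have hs : Function.Surjective (Ideal.Quotient.mk J) := Ideal.Quotient.mk_surjective
    have : IsLocalHom (Ideal.Quotient.mk J) := IsLocalHom.of_surjective _ hs
    have e : IsLocalHom (Ideal.Quotient.mk J) ↔
      (maximalIdeal (T ⧸ J)).comap (Ideal.Quotient.mk J) = maximalIdeal T :=
      (local_hom_TFAE (Ideal.Quotient.mk J)).out 0 4
    rw [← e.mp inferInstance]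
    exact Ideal.map_comap_of_surjective _ hs _
  rw [← h1, ← h, Ideal.map_sup, Ideal.map_quotient_self, bot_sup_eq]

lemma aux_dim_quot (T : Type*) [CommRing T] [IsLocalRing T] [IsNoetherianRing T]
    (x : T) (hx : x ∈ maximalIdeal T) (n : ℕ) (h : ((n + 1 : ℕ) : WithBot ℕ∞) ≤ ringKrullDim T) :
    (n : WithBot ℕ∞) ≤ ringKrullDim (T ⧸ Ideal.span {x}) := by
  have := ringKrullDim_le_ringKrullDim_quotient_add_card ({x} : Finset T)
    (by simpa [IsLocalRing.ringJacobson_eq_maximalIdeal] using hx)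
  simp only [Finset.coe_singleton, Finset.card_singleton] at this
  have h2 := h.trans this
  push_cast at h2
  rw [Finset.coe_singleton] at h2
  generalize ringKrullDim (T ⧸ Ideal.span {x}) = d at h2 ⊢
  induction d using WithBot.recBotCoe with
  | bot => exact absurd h2 (by rw [WithBot.bot_add, le_bot_iff]; exact WithBot.coe_ne_bot)
  | coe d =>
    have h3 : ((n : ℕ∞) + 1) ≤ d + 1 := by exact_mod_cast h2
    have h4 : (n : ℕ∞) ≤ d := (ENat.add_le_add_iff_right (by simp)).mp h3
    exact_mod_cast h4

lemma aux_prime_min (T : Type*) [CommRing T] [IsLocalRing T] [IsNoetherianRing T]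
    (x : T) (hx : x ∈ maximalIdeal T) (hp : (Ideal.span {x}).IsPrime)
    (hmin : Ideal.span {x} ∉ minimalPrimes T) : IsDomain T := by
  obtain ⟨q, hq, hqx⟩ := Ideal.exists_minimalPrimes_le (I := ⊥) (J := Ideal.span {x}) bot_le
  have hqp : q.IsPrime := hq.1.1
  have hxq : x ∉ q := fun h => hmin (by
    have : q = Ideal.span {x} := le_antisymm hqx ((Ideal.span_singleton_le_iff_mem _).mpr h)
    exact this ▸ hq)
  have : q = ⊥ := by
    refine Submodule.eq_bot_of_le_smul_of_le_jacobson_bot (maximalIdeal T) q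
      (IsNoetherian.noetherian q) ?_ (IsLocalRing.maximalIdeal_le_jacobson _)
    intro y hy
    obtain ⟨z, rfl⟩ := Ideal.mem_span_singleton'.mp (hqx hy)
    have hz : z ∈ q := (hqp.mem_or_mem hy).resolve_right hxq
    rw [mul_comm]
    exact Submodule.smul_mem_smul hx hz
  subst this
  exact IsDomain.of_bot_isPrime T

theorem aux_regular_domain (n : ℕ) : ∀ (T : Type*) [CommRing T] [IsLocalRing T]
    [IsNoetherianRing T] (l : List T), l.length = n → Ideal.ofList l = maximalIdeal T →
    (n : WithBot ℕ∞) ≤ ringKrullDim T → IsDomain T := by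
  induction n with
  | zero =>
    intro T _ _ _ l hl hm _
    obtain rfl := List.length_eq_zero_iff.mp hl
    have : IsField T := by
      rw [IsLocalRing.isField_iff_maximalIdeal_eq, ← hm]; simp
    exact this.isDomain
  | succ n ih =>
    intro T _ _ _ l hl hm hd
    -- principal ideals generated by part of a system of parameters are prime
    have key : ∀ (x : T) (l' : List T), l'.length = n → Ideal.ofList (x :: l') = maximalIdeal T →
        x ∈ maximalIdeal T ∧ (Ideal.span {x}).IsPrime := by
      intro x l' hl' hm'
      have hx : x ∈ maximalIdeal T := hm' ▸ Ideal.subset_span (by simp)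
      have hne : Ideal.span {x} ≠ ⊤ := fun h =>
        (maximalIdeal.isMaximal T).ne_top (top_le_iff.mp (h ▸ (Ideal.span_singleton_le_iff_mem _).mpr hx))
      have : Nontrivial (T ⧸ Ideal.span {x}) := Ideal.Quotient.nontrivial_iff.mpr hne
      have : IsLocalRing (T ⧸ Ideal.span {x}) :=
        IsLocalRing.of_surjective' (Ideal.Quotient.mk _) Ideal.Quotient.mk_surjective
      refine ⟨hx, ?_⟩
      rw [← Ideal.Quotient.isDomain_iff_prime]
      refine ih (T ⧸ Ideal.span {x}) (l'.map (Ideal.Quotient.mk _)) (by simpa using hl') ?_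
        (aux_dim_quot T x hx n hd)
      rw [← Ideal.map_ofList]
      exact aux_quot_max T _ _ (by rw [← Ideal.ofList_cons, hm'])
    match l, hl with
    | x :: [], hl =>
      obtain rfl : n = 0 := by simpa using hl.symm
      obtain ⟨hx, hp⟩ := key x [] rfl hm
      refine aux_prime_min T x hx hp fun hmin => ?_
      have hm2 : Ideal.span {x} = maximalIdeal T := by rw [← hm]; simp
      have h0 := Ideal.height_eq_zero_iff.mpr hmin
      have h1 := IsLocalRing.maximalIdeal_height_eq_ringKrullDim (R := T)
      rw [← hm2, h0] at h1
      rw [← h1] at hd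
      norm_num at hd
    | x :: y :: l', hl =>
      by_contra hD
      have hl2 : l'.length + 1 = n := by simpa using hl
      have hgen : ∀ k : ℕ, Ideal.ofList ((x + y ^ (k + 1)) :: y :: l') = maximalIdeal T := by
        intro k
        rw [← hm]
        simp only [Ideal.ofList_cons, ← sup_assoc]
        congr 1
        rw [← Ideal.span_union, ← Ideal.span_union]
        apply le_antisymm
        · rw [Ideal.span_le]
          have hx : x ∈ Ideal.span ({x} ∪ {y} : Set T) := Ideal.subset_span (by simp)
          have hy : y ∈ Ideal.span ({x} ∪ {y} : Set T) := Ideal.subset_span (by simp)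
          rintro z (rfl | rfl)
          · exact add_mem hx (Ideal.pow_mem_of_mem _ hy _ (Nat.succ_pos _))
          · exact hy
        · rw [Ideal.span_le]
          have hx : x + y ^ (k+1) ∈ Ideal.span ({x + y ^ (k+1)} ∪ {y} : Set T) :=
            Ideal.subset_span (by simp)
          have hy : y ∈ Ideal.span ({x + y ^ (k+1)} ∪ {y} : Set T) := Ideal.subset_span (by simp)
          rintro z (rfl | rfl)
          · have := sub_mem hx (Ideal.pow_mem_of_mem _ hy (k+1) (Nat.succ_pos _))
            simpa using this
          · exact hy
      have hmin : ∀ k : ℕ, Ideal.span {x + y ^ (k + 1)} ∈ minimalPrimes T := by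
        intro k
        by_contra hk
        obtain ⟨h1, h2⟩ := key _ (y :: l') hl2 (hgen k)
        exact hD (aux_prime_min T _ h1 h2 hk)
      obtain ⟨i, j, hij, he⟩ : ∃ i j : ℕ, i < j ∧
          Ideal.span {x + y ^ (i + 1)} = Ideal.span {x + y ^ (j + 1)} := by
        have hfin := minimalPrimes.finite_of_isNoetherianRing T
        obtain ⟨i, -, j, -, hne, he⟩ := Set.infinite_univ.exists_ne_map_eq_of_mapsTo
          (f := fun k : ℕ => Ideal.span {x + y ^ (k + 1)}) (fun k _ => hmin k) hfin
        rcases lt_or_gt_of_ne hne with h | h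
        · exact ⟨i, j, h, he⟩
        · exact ⟨j, i, h, he.symm⟩
      obtain ⟨hz, hP⟩ := key _ (y :: l') hl2 (hgen i)
      set q := Ideal.span {x + y ^ (i + 1)} with hq
      have hi : x + y ^ (i + 1) ∈ q := Ideal.subset_span rfl
      have hj : x + y ^ (j + 1) ∈ q := he ▸ Ideal.subset_span rfl
      have hym : y ∈ maximalIdeal T := hm ▸ Ideal.subset_span (by simp)
      have hyq : y ∈ q := by
        have h1 : y ^ (i + 1) * (1 - y ^ (j - i)) ∈ q := by
          have := sub_mem hi hj
          convert this using 1
          have : y ^ (j + 1) = y ^ (i + 1) * y ^ (j - i) := by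
            rw [← pow_add]; congr 1; omega
          rw [this]; ring
        rcases hP.mem_or_mem h1 with h | h
        · exact hP.mem_of_pow_mem _ h
        · exfalso
          have hu : IsUnit (1 - y ^ (j - i)) := by
            by_contra hu
            have h2 : (1 - y ^ (j - i)) ∈ maximalIdeal T := (mem_maximalIdeal _).mpr hu
            have h3 := add_mem h2 (Ideal.pow_mem_of_mem _ hym (j - i) (by omega))
            rw [sub_add_cancel] at h3
            exact (maximalIdeal.isMaximal T).ne_top ((Ideal.eq_top_iff_one _).mpr h3)
          exact hP.ne_top (Ideal.eq_top_of_isUnit_mem _ h hu)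
      have : Nontrivial (T ⧸ q) := Ideal.Quotient.nontrivial_iff.mpr hP.ne_top
      have : IsLocalRing (T ⧸ q) :=
        IsLocalRing.of_surjective' (Ideal.Quotient.mk _) Ideal.Quotient.mk_surjective
      have hd1 : (n : WithBot ℕ∞) ≤ ringKrullDim (T ⧸ q) := aux_dim_quot T _ hz n hd
      have hd2 := aux_dim_le l'.length (T ⧸ q) (l'.map (Ideal.Quotient.mk q)) (by simp) (by
        rw [← Ideal.map_ofList]
        refine aux_quot_max T _ _ ?_
        rw [← hgen i, Ideal.ofList_cons, Ideal.ofList_cons, ← sup_assoc]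
        congr 1
        exact (sup_eq_left.mpr ((Ideal.span_singleton_le_iff_mem _).mpr hyq)).symm)
      have h3 := hd1.trans hd2
      have h4 : n ≤ l'.length := by exact_mod_cast h3
      omega

lemma aux_colon {A R : Type*} [CommRing A] [CommRing R] [Algebra A R] [Module.Flat A R]
    (J : Ideal A) (a : A) (K : Ideal A) (hK : ∀ c, a * c ∈ J → c ∈ K) (r : R)
    (h : algebraMap A R a * r ∈ J.map (algebraMap A R)) : r ∈ K.map (algebraMap A R) := by
  classical
  have h' : ∃ (n : ℕ) (g : Fin n → A) (s : Fin n → R), (∀ i, g i ∈ J) ∧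
      algebraMap A R a * r = ∑ i, algebraMap A R (g i) * s i := by
    rw [Ideal.map] at h
    obtain ⟨n, c, g, hg⟩ := Submodule.mem_span_set'.mp h
    choose g' hg' hg'' using fun i => (g i).2
    refine ⟨n, g', c, hg', ?_⟩
    rw [← hg]
    refine Finset.sum_congr rfl fun i _ => ?_
    rw [hg'', smul_eq_mul, mul_comm]
  obtain ⟨n, g, s, hg, he⟩ := h'
  have hrel : ∑ i : Option (Fin n), (Option.elim i a (fun i => - g i)) • (Option.elim i r s) = 0 := by
    rw [Fintype.sum_option]
    simp [Algebra.smul_def, he]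
  obtain ⟨k, c, y, h1, h2⟩ := Module.Flat.isTrivialRelation_of_sum_smul_eq_zero (R := A) (M := R) hrel
  have hr := h1 none
  simp only [Option.elim] at hr
  rw [hr]
  refine sum_mem fun j _ => ?_
  rw [Algebra.smul_def]
  refine Ideal.mul_mem_right _ _ (Ideal.mem_map_of_mem _ (hK _ ?_))
  have := h2 j
  rw [Fintype.sum_option] at this
  simp only [Option.elim, neg_mul, Finset.sum_neg_distrib] at this
  rw [add_neg_eq_zero.mp this]
  exact sum_mem fun i _ => Ideal.mul_mem_right _ _ (hg i)

lemma aux_primary {A R : Type*} [CommRing A] [CommRing R] [IsLocalRing A]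
    [IsNoetherianRing A] [Algebra A R] [Module.Flat A R] (f : R)
    (hf : ∀ x, f * x ∈ (maximalIdeal A).map (algebraMap A R) →
      x ∈ (maximalIdeal A).map (algebraMap A R)) (k : ℕ) (J : Ideal A) :
    maximalIdeal A ^ k ≤ J → ∀ x, f * x ∈ J.map (algebraMap A R) →
      x ∈ J.map (algebraMap A R) := by
  classical
  induction J using IsNoetherian.induction with
  | _ J ih =>
  intro hk x hx
  by_cases hJ : J = ⊤
  · subst hJ; rw [Ideal.map_top]; trivial
  have hex : ∃ k, maximalIdeal A ^ k ≤ J := ⟨k, hk⟩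
  obtain ⟨a, haJ, ha⟩ : ∃ a, a ∉ J ∧ ∀ c ∈ maximalIdeal A, a * c ∈ J := by
    rcases hn : Nat.find hex with _ | d
    · exfalso
      have := Nat.find_spec hex
      rw [hn, pow_zero, Ideal.one_eq_top, top_le_iff] at this
      exact hJ this
    · have h1 : ¬ maximalIdeal A ^ d ≤ J := Nat.find_min hex (by omega)
      obtain ⟨a, ha, haJ⟩ := SetLike.not_le_iff_exists.mp h1
      refine ⟨a, haJ, fun c hc => ?_⟩
      have h2 := Nat.find_spec hex
      rw [hn, pow_succ] at h2
      exact h2 (Ideal.mul_mem_mul ha hc)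
  have hlt : J < J ⊔ Ideal.span {a} := by
    refine lt_of_le_of_ne le_sup_left fun h => haJ ?_
    rw [h]
    exact Ideal.mem_sup_right (Ideal.subset_span rfl)
  have hx2 := ih _ hlt (hk.trans le_sup_left) x (Ideal.map_mono le_sup_left hx)
  rw [Ideal.map_sup, Ideal.map_span, Set.image_singleton] at hx2
  obtain ⟨y, hy, z, hz, rfl⟩ := Submodule.mem_sup.mp hx2
  obtain ⟨r, rfl⟩ := Ideal.mem_span_singleton'.mp hz
  refine add_mem hy ?_
  have h3 : algebraMap A R a * (f * r) ∈ Ideal.map (algebraMap A R) J := by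
    have := sub_mem hx (Ideal.mul_mem_left _ f hy)
    convert this using 1
    ring
  have h4 := hf r (aux_colon J a (maximalIdeal A) (fun c hc => by
    rw [mem_maximalIdeal, mem_nonunits_iff]
    intro hu
    exact haJ ((Ideal.mul_unit_mem_iff_mem J hu).mp hc)) _ h3)
  rw [Ideal.map] at h4
  refine Submodule.span_induction (p := fun r _ => r * algebraMap A R a ∈ Ideal.map (algebraMap A R) J)
    ?_ ?_ ?_ ?_ h4
  · rintro _ ⟨c, hc, rfl⟩
    rw [mul_comm, ← map_mul]
    exact Ideal.mem_map_of_mem _ (ha c hc)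
  · simp
  · intro u v _ _ hu hv
    rw [add_mul]; exact add_mem hu hv
  · intro u v _ hv
    rw [smul_eq_mul, mul_assoc]; exact Ideal.mul_mem_left _ _ hv

lemma aux_regular {A R : Type*} [CommRing A] [CommRing R] [IsLocalRing A] [IsLocalRing R]
    [IsNoetherianRing A] [IsNoetherianRing R] [Algebra A R] [IsLocalHom (algebraMap A R)]
    [Module.Flat A R] (f : R)
    (hf : ∀ x, f * x ∈ (maximalIdeal A).map (algebraMap A R) →
      x ∈ (maximalIdeal A).map (algebraMap A R)) (J : Ideal A) (x : R)
    (hx : f * x ∈ J.map (algebraMap A R)) : x ∈ J.map (algebraMap A R) := by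
  have hmn : (maximalIdeal A).map (algebraMap A R) ≤ maximalIdeal R :=
    have e : IsLocalHom (algebraMap A R) ↔
      (maximalIdeal A).map (algebraMap A R) ≤ maximalIdeal R :=
      (local_hom_TFAE (algebraMap A R)).out 0 2
    e.mp inferInstance
  have h1 : ∀ k, x ∈ J.map (algebraMap A R) ⊔ maximalIdeal R ^ k := by
    intro k
    have h := aux_primary f hf k (J ⊔ maximalIdeal A ^ k) le_sup_right x
      (Ideal.map_mono le_sup_left hx)
    rw [Ideal.map_sup, Ideal.map_pow] at h
    exact sup_le_sup_left (Ideal.pow_right_mono hmn k) _ h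
  have h2 := Ideal.iInf_pow_smul_eq_bot_of_isLocalRing (M := R ⧸ J.map (algebraMap A R))
    (maximalIdeal R) (maximalIdeal.isMaximal R).ne_top
  rw [← Ideal.Quotient.eq_zero_iff_mem, ← Submodule.mem_bot (R := R), ← h2, Submodule.mem_iInf]
  intro k
  obtain ⟨y, hy, z, hz, hyz⟩ := Submodule.mem_sup.mp (h1 k)
  rw [← hyz, map_add, Ideal.Quotient.eq_zero_iff_mem.mpr hy, zero_add]
  have : Ideal.Quotient.mk (J.map (algebraMap A R)) z =
      z • (1 : R ⧸ J.map (algebraMap A R)) := by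
    rw [Algebra.smul_def, mul_one]; rfl
  rw [this]
  exact Submodule.smul_mem_smul hz trivial

/-- Proposition 1.8 of the paper. Let `(A,m) → (R,n)` be a flat local
homomorphism of Noetherian local rings with `k(n)` separable over `k(m)` and `R ⊗_A k(m)`
regular. Let `I ⊊ R` be a proper ideal such that (a) no prime ideal in the image of
`V(I)` under `Spec R → Spec A` is contained in an associated prime of `A`, and
(b) `I ⊄ mR`. Then `depth(I,R) ≥ 2`. -/
theorem depth_ge_two_of_flat_local
    (A R : Type*) [CommRing A] [CommRing R] [IsLocalRing A] [IsLocalRing R]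
    [IsNoetherianRing A] [IsNoetherianRing R]
    [Algebra A R] [IsLocalHom (algebraMap A R)] [Module.Flat A R]
    (hsep : letI : Algebra (ResidueField A) (ResidueField R) :=
        (ResidueField.map (algebraMap A R)).toAlgebra
      Algebra.IsSeparable (ResidueField A) (ResidueField R))
    (hreg : ∃ n : ℕ, IsRegularLocalOfDim (TensorProduct A (ResidueField A) R) n)
    (I : Ideal R) (hI : I ≠ ⊤)
    (ha : ∀ q : Ideal R, q.IsPrime → I ≤ q →
      ∀ p : Ideal A, IsAssociatedPrime p A → ¬ q.comap (algebraMap A R) ≤ p)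
    (hb : ¬ I ≤ (maximalIdeal A).map (algebraMap A R)) :
    2 ≤ idealDepth R I := by
  classical
  -- the extended maximal ideal is prime
  have hprime : ((maximalIdeal A).map (algebraMap A R)).IsPrime := by
    obtain ⟨n, hN, hL, s, hs, hc, hd⟩ := hreg
    have hD : IsDomain (TensorProduct A (ResidueField A) R) :=
      aux_regular_domain n _ s.toList (by simpa using hc)
        (by rw [← hs]; unfold Ideal.ofList; congr 1; ext; simp) hd.ge
    rw [← Ideal.Quotient.isDomain_iff_prime]
    have hD' : IsDomain (TensorProduct A (A ⧸ maximalIdeal A) R) := hD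
    exact (Algebra.TensorProduct.quotIdealMapEquivQuotTensor R
      (maximalIdeal A)).toRingEquiv.toMulEquiv.isDomain _
  obtain ⟨f, hfI, hfm⟩ := SetLike.not_le_iff_exists.mp hb
  have hreg' := aux_regular (A := A) f (fun x hx => (hprime.mem_or_mem hx).resolve_left hfm)
  have hImax : I ≤ maximalIdeal R := le_maximalIdeal hI
  have hf : IsSMulRegular R f := by
    rw [isSMulRegular_iff_right_eq_zero_of_smul]
    intro x hx
    have := hreg' ⊥ x (by rw [← smul_eq_mul, hx]; exact zero_mem _)
    simpa using this
  -- nonzerodivisors of `A` stay regular modulo `f`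
  have hA : ∀ a ∈ nonZeroDivisors A, IsSMulRegular (QuotSMulTop f R) (algebraMap A R a) := by
    intro a haA
    have haR : IsSMulRegular R a := Module.Flat.isSMulRegular_of_nonZeroDivisors haA
    rw [isSMulRegular_iff_right_eq_zero_of_smul]
    intro m hm
    obtain ⟨x, rfl⟩ := Submodule.Quotient.mk_surjective _ m
    rw [← Submodule.Quotient.mk_smul, Submodule.Quotient.mk_eq_zero] at hm
    rw [Submodule.Quotient.mk_eq_zero]
    obtain ⟨y, -, hy⟩ := Submodule.mem_smul_pointwise_iff_exists _ _ _ |>.mp hm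
    simp only [smul_eq_mul] at hy
    have h1 := hreg' (Ideal.span {a}) y (by
      rw [hy, Ideal.map_span, Set.image_singleton]
      exact Ideal.mul_mem_right _ _ (Ideal.subset_span rfl))
    rw [Ideal.map_span, Set.image_singleton] at h1
    obtain ⟨z, rfl⟩ := Ideal.mem_span_singleton'.mp h1
    have h2 : x = f * z := by
      apply haR
      simp only [Algebra.smul_def]
      rw [← hy]; ring
    rw [h2]
    exact Submodule.smul_mem_pointwise_smul z f ⊤ trivial
  -- an element of `I` regular modulo `f`
  obtain ⟨g, hgI, hg⟩ : ∃ g ∈ I, IsSMulRegular (QuotSMulTop f R) g := by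
    by_contra! hcon
    have hsub : (I : Set R) ⊆ ⋃ p ∈ associatedPrimes R (QuotSMulTop f R), (p : Set R) := by
      rw [biUnion_associatedPrimes_eq_compl_regular]
      exact fun g hg => hcon g hg
    obtain ⟨q, hq, hIq⟩ := (Ideal.subset_union_prime_finite
      (associatedPrimes.finite R (QuotSMulTop f R)) (f := id) ⊥ ⊥
      (fun p hp _ _ => hp.isPrime)).mp hsub
    have hnot : ¬ ((q.comap (algebraMap A R) : Ideal A) : Set A) ⊆
        ⋃ p ∈ associatedPrimes A A, (p : Set A) := by
      intro h
      obtain ⟨p, hp, hqp⟩ := (Ideal.subset_union_prime_finite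
        (associatedPrimes.finite A A) (f := id) ⊥ ⊥ (fun p hp _ _ => hp.isPrime)).mp h
      exact ha q hq.isPrime hIq p hp hqp
    rw [biUnion_associatedPrimes_eq_compl_nonZeroDivisors] at hnot
    obtain ⟨a, haq, han⟩ := Set.not_subset.mp hnot
    have h1 := hA a (by simpa using han)
    have h2 : algebraMap A R a ∈ ⋃ p ∈ associatedPrimes R (QuotSMulTop f R), (p : Set R) :=
      Set.mem_biUnion hq haq
    rw [biUnion_associatedPrimes_eq_compl_regular] at h2
    exact h2 h1
  refine le_sSup ⟨[f, g], ?_, ?_, rfl⟩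
  · simp [hfI, hgI]
  · rw [IsLocalRing.isRegular_iff_isWeaklyRegular_of_subset_maximalIdeal
      (by simp [- mem_maximalIdeal, hImax hfI, hImax hgI])]
    simp [isWeaklyRegular_cons_iff, hf, hg]
end

section
/- Let g : X → S be a morphism of algebraic varieties over an algebraically closed field k such that every fiber g⁻¹(s), s ∈ S, is irreducible of dimension d ≥ 1. Then every irreducible component of X is a union of fibers of g, and every irreducible component of S is dominated by a unique irreducible component of X. -/
open AlgebraicGeometry CategoryTheory
section CUF_sec1
open Cardinal

theorem CUF_comap_max (k A B : Type) [Field k] [CommRing A] [CommRing B] [Algebra k A] [Algebra k B]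
    [Algebra A B] [IsScalarTower k A B] [Algebra.FiniteType k B] (n : Ideal B) [hn : n.IsMaximal] :
    (n.comap (algebraMap A B)).IsMaximal := by
  let := Ideal.Quotient.field n
  have : Algebra.FiniteType k (B ⧸ n) := inferInstance
  have : Module.Finite k (B ⧸ n) := finite_of_finite_type_of_isJacobsonRing k (B ⧸ n)
  have : Algebra.IsIntegral A (B ⧸ n) := Algebra.IsIntegral.tower_top k
  have h := Ideal.isMaximal_comap_of_isIntegral_of_isMaximal (R := A) (⊥ : Ideal (B ⧸ n))
  convert h
  ext x
  rw [Ideal.mem_comap, Ideal.mem_comap, IsScalarTower.algebraMap_apply A B (B ⧸ n), Ideal.mem_bot,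
    Ideal.Quotient.algebraMap_eq, Ideal.Quotient.eq_zero_iff_mem]

theorem CUF_mvpoly_height (k : Type) [Field k] (s : ℕ) (m : Ideal (MvPolynomial (Fin s) k))
    [m.IsMaximal] : m.height = s := by
  induction s with
  | zero =>
    have hF : IsField (MvPolynomial (Fin 0) k) :=
      (MvPolynomial.isEmptyRingEquiv k (Fin 0)).toMulEquiv.isField (Field.toIsField k)
    have h0 : m = ⊥ := by
      by_contra h
      exact (Ring.not_isField_iff_exists_prime.mpr ⟨m, h, inferInstance⟩) hF
    subst h0
    simp
  | succ s ih =>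
    let e := (MvPolynomial.finSuccEquiv k s).toRingEquiv
    let P : Ideal (Polynomial (MvPolynomial (Fin s) k)) := m.map e
    have hP : P.IsMaximal := Ideal.map_isMaximal_of_equiv e
    have hu : (P.comap (Polynomial.C)).IsMaximal :=
      Polynomial.isMaximal_comap_C_of_isJacobsonRing P
    have : P.LiesOver (P.comap Polynomial.C) := ⟨rfl⟩
    have := Polynomial.height_eq_height_add_one (P.comap Polynomial.C) P
    rw [ih] at this
    rw [← e.height_map m]
    push_cast
    exact this

theorem CUF_height_eq_trdeg (k : Type) [Field k] (D : Type) [CommRing D] [IsDomain D] [Algebra k D]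
    [Algebra.FiniteType k D] : ∃ t : ℕ, Algebra.trdeg k D = t ∧
      ∀ n : Ideal D, n.IsMaximal → n.height = t := by
  obtain ⟨s, g, hinj, hitg⟩ := exists_integral_inj_algHom_of_fg k D
  let := g.toRingHom.toAlgebra
  have : IsScalarTower k (MvPolynomial (Fin s) k) D := .of_algebraMap_eq (fun x => (g.commutes x).symm)
  have : FaithfulSMul (MvPolynomial (Fin s) k) D := (faithfulSMul_iff_algebraMap_injective _ _).2 hinj
  have : Algebra.IsIntegral (MvPolynomial (Fin s) k) D := ⟨hitg⟩
  have : IsNoetherianRing D := Algebra.FiniteType.isNoetherianRing k D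
  refine ⟨s, ?_, ?_⟩
  · have := trdeg_add_eq k (MvPolynomial (Fin s) k) (A := D)
    rw [← this, trdeg_eq_zero (R := MvPolynomial (Fin s) k) (A := D)]
    simp
  · intro n hn
    have hm : (n.under (MvPolynomial (Fin s) k)).IsMaximal :=
      Ideal.isMaximal_comap_of_isIntegral_of_isMaximal _
    have h0 := CUF_mvpoly_height k s (n.under (MvPolynomial (Fin s) k))
    apply le_antisymm
    · rw [← h0]
      have := Order.height_le_height_apply_of_strictMono
        (PrimeSpectrum.comap (algebraMap (MvPolynomial (Fin s) k) D))
        (fun p q hpq => Ideal.IsIntegral.comap_lt_comap (R := MvPolynomial (Fin s) k) hpq)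
        ⟨n, hn.isPrime⟩
      rw [← PrimeSpectrum.height_eq_orderHeight, ← PrimeSpectrum.height_eq_orderHeight] at this
      exact this
    · have h := Ideal.height_eq_height_add_of_liesOver_of_hasGoingDown (n.under (MvPolynomial (Fin s) k)) n
      rw [h0] at h
      rw [h]
      exact le_self_add

/-- trdeg bound -/
theorem CUF_a (k A B : Type) [Field k] [CommRing A] [CommRing B] [IsDomain A] [IsDomain B]
    [Algebra k A] [Algebra k B]
    [Algebra A B] [IsScalarTower k A B] [Algebra.FiniteType k B] [FaithfulSMul A B] :
    ∃ c : B, c ≠ 0 ∧ ∀ (D : Type) [CommRing D] [IsDomain D] [Algebra k D] (π : B →ₐ[k] D)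
      (_ : Function.Surjective π) (_ : ∀ a : A, IsIntegral k (π (algebraMap A B a))) (_ : π c ≠ 0),
      Algebra.trdeg k D ≤ Algebra.trdeg A B := by
  obtain ⟨s, hs⟩ := exists_isTranscendenceBasis A B
  have halg := hs.isAlgebraic
  rw [Subtype.range_coe] at halg
  obtain ⟨G, hG⟩ := ‹Algebra.FiniteType k B›
  obtain ⟨c, hc, hci⟩ := Algebra.IsAlgebraic.exists_integral_multiples (Algebra.adjoin A s) G
  refine ⟨c, by simpa using hc, fun D _ _ _ π hπ hA hπc => ?_⟩
  rw [← hs.cardinalMk_eq_trdeg]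
  refine le_trans ?_ (Cardinal.mk_image_le (s := s) (f := π))
  suffices h : Algebra.IsAlgebraic (Algebra.adjoin k (π '' s)) D from
    Algebra.IsAlgebraic.trdeg_le_cardinalMk k (π '' s)
  let S0 := Algebra.adjoin k (π '' s)
  let T : Subalgebra k D := (Subalgebra.algebraicClosure S0 D).restrictScalars k
  have h1 : ∀ b ∈ Algebra.adjoin A s, IsAlgebraic S0 (π b) := by
    intro b hb
    induction hb using Algebra.adjoin_induction with
    | mem x hx =>
      have : π x ∈ S0 := Algebra.subset_adjoin ⟨x, hx, rfl⟩
      exact isAlgebraic_algebraMap (R := S0) (A := D) ⟨π x, this⟩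
    | algebraMap a => exact ((hA a).tower_top (A := S0)).isAlgebraic
    | add x y _ _ hx hy => rw [map_add]; exact hx.add hy
    | mul x y _ _ hx hy => rw [map_mul]; exact hx.mul hy
  have h3 : ∀ b ∈ G, IsAlgebraic S0 (π b) := by
    intro b hb
    let AC := Subalgebra.algebraicClosure S0 D
    let φ : Algebra.adjoin A s →+* AC :=
      ((π : B →+* D).comp (algebraMap (Algebra.adjoin A s) B)).codRestrict AC
        (fun x => h1 x x.2)
    have h3 : IsIntegral AC (π (c • b)) := (hci b hb).map_of_comp_eq φ (π : B →+* D) (by ext; rfl)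
    have h4 : π (c • b) = φ c • π b := by
      rw [Algebra.smul_def, Algebra.smul_def, map_mul]; rfl
    rw [h4] at h3
    have hφ : φ c ≠ 0 := fun h => hπc (congrArg Subtype.val h)
    exact (IsAlgebraic.of_smul (mem_nonZeroDivisors_of_ne_zero hφ) h3.isAlgebraic).restrictScalars S0
  refine ⟨fun y => ?_⟩
  obtain ⟨b, rfl⟩ := hπ y
  have hb : b ∈ Algebra.adjoin k (G : Set B) := hG ▸ trivial
  have h4 : Algebra.adjoin k (G : Set B) ≤ T.comap π := Algebra.adjoin_le (fun b hb => h3 b hb)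
  exact h4 hb

theorem CUF_master (k A B : Type) [Field k] [CommRing A] [CommRing B]
    [Algebra k A] [Algebra k B] [Algebra A B] [IsScalarTower k A B]
    [Algebra.FiniteType k A] [Algebra.FiniteType k B] (q : Ideal B) [q.IsPrime] :
    ∃ e : ℕ,
      (∃ c : B, c ∉ q ∧ ∀ (n P : Ideal B), n.IsMaximal → c ∉ n → P.IsPrime → P ≤ n → q ≤ P →
        (P.comap (algebraMap A B)).IsMaximal → (n.map (Ideal.Quotient.mk P)).height ≤ e) ∧
      (∀ (n P : Ideal B), n.IsMaximal → q ≤ n → P.IsPrime → P ≤ n →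
        P ≤ ((n.comap (algebraMap A B)).map (algebraMap A B)).radical → ¬ q ≤ P →
        ((e + 1 : ℕ) : ℕ∞) ≤ (n.map (Ideal.Quotient.mk P)).height) := by
  let q0 := q.under A
  have : FaithfulSMul (A ⧸ q0) (B ⧸ q) := inferInstance
  have : IsScalarTower k (A ⧸ q0) (B ⧸ q) := inferInstance
  obtain ⟨tA, htA, hA⟩ := CUF_height_eq_trdeg k (A ⧸ q0)
  obtain ⟨tB, htB, hB⟩ := CUF_height_eq_trdeg k (B ⧸ q)
  have hadd := trdeg_add_eq k (A ⧸ q0) (A := B ⧸ q)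
  have hlt : Algebra.trdeg (A ⧸ q0) (B ⧸ q) < ℵ₀ := by
    refine lt_of_le_of_lt ?_ (Cardinal.natCast_lt_aleph0 (n := tB))
    rw [← htB, ← hadd]; exact le_add_self
  obtain ⟨e, he⟩ := Cardinal.lt_aleph0.1 hlt
  rw [htA, htB, he] at hadd
  have hadd' : tA + e = tB := by exact_mod_cast hadd
  have hBN : IsNoetherianRing B := Algebra.FiniteType.isNoetherianRing k B
  have hAN : IsNoetherianRing A := Algebra.FiniteType.isNoetherianRing k A
  refine ⟨e, ?_, ?_⟩
  · obtain ⟨c, hc, H⟩ := CUF_a k (A ⧸ q0) (B ⧸ q)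
    obtain ⟨c, rfl⟩ := Ideal.Quotient.mk_surjective c
    refine ⟨c, by rwa [Ne, Ideal.Quotient.eq_zero_iff_mem] at hc, ?_⟩
    intro n P hn hcn hP hPn hqP hmax
    obtain ⟨tD, htD, hD⟩ := CUF_height_eq_trdeg k (B ⧸ P)
    have hn' : (n.map (Ideal.Quotient.mk P)).IsMaximal := by
      refine .map_of_surjective_of_ker_le Ideal.Quotient.mk_surjective ?_
      rwa [Ideal.mk_ker]
    rw [hD _ hn']
    have := H (B ⧸ P) (Ideal.Quotient.factorₐ k hqP) (Ideal.Quotient.factor_surjective hqP) ?_ ?_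
    · rw [htD, he] at this
      exact_mod_cast this
    · intro a
      obtain ⟨a, rfl⟩ := Ideal.Quotient.mk_surjective a
      let m := P.under A
      have hm : m.IsMaximal := hmax
      let := Ideal.Quotient.field m
      have : Module.Finite k (A ⧸ m) := finite_of_finite_type_of_isJacobsonRing k (A ⧸ m)
      have hi : IsIntegral k (Ideal.Quotient.mk m a) := Algebra.IsIntegral.isIntegral _
      exact hi.map (IsScalarTower.toAlgHom k (A ⧸ m) (B ⧸ P))
    · intro h
      have : c ∈ P := by
        rw [← Ideal.Quotient.eq_zero_iff_mem]; exact h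
      exact hcn (hPn this)
  · intro n P hn hqn hP hPn hPr hqP
    let N := n.map (Ideal.Quotient.mk q)
    have hN : N.IsMaximal := by
      refine .map_of_surjective_of_ker_le Ideal.Quotient.mk_surjective ?_
      rwa [Ideal.mk_ker]
    let p := N.under (A ⧸ q0)
    have hp : p.IsMaximal := CUF_comap_max k (A ⧸ q0) (B ⧸ q) N
    have hle := Ideal.height_le_height_add_of_liesOver p N
    rw [hB N hN, hA p hp, ← hadd'] at hle
    let J := p.map (algebraMap (A ⧸ q0) (B ⧸ q))
    have hJN : J ≤ N := Ideal.map_comap_le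
    have hN2 : (N.map (Ideal.Quotient.mk J)).IsMaximal := by
      refine .map_of_surjective_of_ker_le Ideal.Quotient.mk_surjective ?_
      rwa [Ideal.mk_ker]
    have hle2 : (e : ℕ∞) ≤ (N.map (Ideal.Quotient.mk J)).height := by
      push_cast at hle
      exact (ENat.add_le_add_iff_left (ENat.natCast_ne_top tA)).1 hle
    have hn' : (n.map (Ideal.Quotient.mk P)).IsMaximal := by
      refine .map_of_surjective_of_ker_le Ideal.Quotient.mk_surjective ?_
      rwa [Ideal.mk_ker]
    let φ : B →+* ((B ⧸ q) ⧸ J) := (Ideal.Quotient.mk J).comp (Ideal.Quotient.mk q)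
    have hφ : Function.Surjective φ := Ideal.Quotient.mk_surjective.comp Ideal.Quotient.mk_surjective
    have hφP : ∀ Q : Ideal ((B ⧸ q) ⧸ J), Q.IsPrime → P ≤ Q.comap φ := by
      intro Q hQ
      refine hPr.trans ((hQ.comap φ).radical_le_iff.2 ?_)
      rw [Ideal.map_le_iff_le_comap]
      intro a ha
      suffices φ (algebraMap A B a) = 0 by
        rw [Ideal.mem_comap, Ideal.mem_comap, this]; exact Q.zero_mem
      refine Ideal.Quotient.eq_zero_iff_mem.2 ?_
      have : Ideal.Quotient.mk q0 a ∈ p := Ideal.mem_map_of_mem (Ideal.Quotient.mk q) ha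
      exact Ideal.mem_map_of_mem (algebraMap (A ⧸ q0) (B ⧸ q)) this
    have hk : ∀ Q : Ideal B, P ≤ Q → (Q.map (Ideal.Quotient.mk P)).comap (Ideal.Quotient.mk P) = Q := by
      intro Q hQ
      rw [Ideal.comap_map_of_surjective' _ Ideal.Quotient.mk_surjective, Ideal.mk_ker]
      simpa using hQ
    let f : PrimeSpectrum ((B ⧸ q) ⧸ J) → PrimeSpectrum (B ⧸ P) := fun Q =>
      ⟨(Q.asIdeal.comap φ).map (Ideal.Quotient.mk P),
        Ideal.map_isPrime_of_surjective Ideal.Quotient.mk_surjective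
          (by rw [Ideal.mk_ker]; exact hφP _ Q.2)⟩
    have hf : StrictMono f := by
      apply Monotone.strictMono_of_injective
      · intro Q Q' h
        exact Ideal.map_mono (Ideal.comap_mono h)
      · intro Q Q' h
        have h := congrArg (fun x => x.asIdeal.comap (Ideal.Quotient.mk P)) h
        simp only [f] at h
        rw [hk _ (hφP _ Q.2), hk _ (hφP _ Q'.2)] at h
        exact PrimeSpectrum.ext (Ideal.comap_injective_of_surjective φ hφ h)
    have hfN : f ⟨_, hN2.isPrime⟩ = ⟨_, hn'.isPrime⟩ := by
      apply PrimeSpectrum.ext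
      change Ideal.map _ (Ideal.comap φ _) = _
      congr 1
      rw [← Ideal.comap_comap, Ideal.comap_map_of_surjective' _ Ideal.Quotient.mk_surjective, Ideal.mk_ker,
        sup_eq_left.2 hJN, Ideal.comap_map_of_surjective' _ Ideal.Quotient.mk_surjective, Ideal.mk_ker,
        sup_eq_left.2 hqn]
    change (e : ℕ∞) ≤ (⟨_, hN2.isPrime⟩ : PrimeSpectrum _).asIdeal.height at hle2
    change _ ≤ (⟨_, hn'.isPrime⟩ : PrimeSpectrum _).asIdeal.height
    rw [PrimeSpectrum.height_eq_orderHeight] at hle2 ⊢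
    obtain ⟨L, hL, hlen⟩ := Order.exists_series_of_le_height _ hle2
    have hbot : (⊥ : PrimeSpectrum (B ⧸ P)) < (L.map f hf).head := by
      rw [bot_lt_iff_ne_bot]
      intro h
      apply hqP
      have h1 : (f L.head).asIdeal = ⊥ := by
        have := congrArg PrimeSpectrum.asIdeal h
        simpa using this
      have h2 := congrArg (Ideal.comap (Ideal.Quotient.mk P)) h1
      simp only [f] at h2
      rw [hk _ (hφP _ L.head.2), ← RingHom.ker_eq_comap_bot, Ideal.mk_ker] at h2
      rw [← h2]
      intro x hx
      have : φ x = 0 := by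
        simp only [φ, RingHom.comp_apply]
        rw [Ideal.Quotient.eq_zero_iff_mem.2 hx, map_zero]
      rw [Ideal.mem_comap, this]; exact Ideal.zero_mem _
    have := Order.length_le_height (p := (L.map f hf).cons ⊥ hbot) (x := ⟨_, hn'.isPrime⟩)
      (by rw [RelSeries.last_cons]; rw [← hfN, ← hL]; exact le_of_eq rfl)
    refine le_trans ?_ this
    simp [hlen]
end CUF_sec1

section CUF_sec2
open TopologicalSpace
theorem CUF_chart_coheight {Y : Type} [TopologicalSpace Y] (D : Type) [CommRing D]
    (f : PrimeSpectrum D → Y) (hf : Topology.IsOpenEmbedding f) (n : PrimeSpectrum D)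
    (hy : IsClosed ({f n} : Set Y)) :
    Order.coheight (⟨{f n}, isIrreducible_singleton, hy⟩ : IrreducibleCloseds Y) = n.asIdeal.height := by
  let Z := OrderDual.ofDual (PrimeSpectrum.pointsEquivIrreducibleCloseds D n)
  have h1 := hf.coheight_map Z
  have h2 : IrreducibleCloseds.map f hf.continuous Z = ⟨{f n}, isIrreducible_singleton, hy⟩ := by
    apply IrreducibleCloseds.ext
    change closure (f '' (closure {n})) = {f n}
    rw [closure_image_closure hf.continuous, Set.image_singleton, hy.closure_eq]
  rw [← h2, h1, PrimeSpectrum.height_eq_orderHeight,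
    ← Order.height_orderIso (PrimeSpectrum.pointsEquivIrreducibleCloseds D) n]
  rfl

theorem CUF_chart_max {Y : Type} [TopologicalSpace Y] (D : Type) [CommRing D]
    (f : PrimeSpectrum D → Y) (hf : Topology.IsOpenEmbedding f) (n : PrimeSpectrum D)
    (hy : IsClosed ({f n} : Set Y)) : n.asIdeal.IsMaximal := by
  rw [← PrimeSpectrum.isClosed_singleton_iff_isMaximal]
  have := hy.preimage hf.continuous
  rwa [← Set.image_singleton, Set.preimage_image_eq _ hf.injective] at this

theorem CUF_dim (k : Type) [Field k] {Y : Type} [TopologicalSpace Y] [JacobsonSpace Y]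
    [IrreducibleSpace Y] (d : ℕ) (hd : topologicalKrullDim Y = d)
    (charts : ∀ y : Y, IsClosed ({y} : Set Y) → ∃ (D : Type) (_ : CommRing D) (_ : IsDomain D)
      (_ : Algebra k D) (_ : Algebra.FiniteType k D) (f : PrimeSpectrum D → Y),
        Topology.IsOpenEmbedding f ∧ y ∈ Set.range f)
    (y : Y) (hy : IsClosed ({y} : Set Y)) :
    Order.coheight (⟨{y}, isIrreducible_singleton, hy⟩ : IrreducibleCloseds Y) = d := by
  have key : ∀ (y y' : Y) (hy : IsClosed ({y} : Set Y)) (hy' : IsClosed ({y'} : Set Y)),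
      Order.coheight (⟨{y}, isIrreducible_singleton, hy⟩ : IrreducibleCloseds Y) =
      Order.coheight (⟨{y'}, isIrreducible_singleton, hy'⟩ : IrreducibleCloseds Y) := by
    intro y y' hy hy'
    obtain ⟨D, _, _, _, _, f, hf, n, rfl⟩ := charts y hy
    obtain ⟨D', _, _, _, _, f', hf', n', rfl⟩ := charts y' hy'
    obtain ⟨t, -, ht⟩ := CUF_height_eq_trdeg k D
    obtain ⟨t', -, ht'⟩ := CUF_height_eq_trdeg k D'
    rw [CUF_chart_coheight D f hf, CUF_chart_coheight D' f' hf', ht _ (CUF_chart_max D f hf _ hy),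
      ht' _ (CUF_chart_max D' f' hf' _ hy')]
    have hne : (Set.range f ∩ Set.range f').Nonempty :=
      nonempty_preirreducible_inter hf.isOpen_range hf'.isOpen_range ⟨_, n, rfl⟩ ⟨_, n', rfl⟩
    obtain ⟨z, ⟨⟨m, rfl⟩, ⟨m', hm'⟩⟩, hz⟩ := nonempty_inter_closedPoints hne
      (hf.isOpen_range.inter hf'.isOpen_range).isLocallyClosed
    have hz : IsClosed {f m} := hz
    have hz' : IsClosed {f' m'} := hm' ▸ hz
    have h1 := CUF_chart_coheight D f hf m hz
    have h2 := CUF_chart_coheight D' f' hf' m' hz'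
    rw [ht _ (CUF_chart_max D f hf _ hz)] at h1
    rw [ht' _ (CUF_chart_max D' f' hf' _ hz')] at h2
    rw [← h1, ← h2]
    congr 3
    exact hm'.symm
  have hne : Nonempty (IrreducibleCloseds Y) := ⟨⟨{y}, isIrreducible_singleton, hy⟩⟩
  rw [topologicalKrullDim, Order.krullDim_eq_iSup_coheight_of_nonempty] at hd
  have hd' : (⨆ a : IrreducibleCloseds Y, Order.coheight a) = d := by exact_mod_cast hd
  rw [← hd']
  refine le_antisymm (le_iSup (fun a : IrreducibleCloseds Y => Order.coheight a) _) (iSup_le fun W => ?_)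
  obtain ⟨z, hzW, hz⟩ := nonempty_inter_closedPoints W.2.nonempty W.3.isLocallyClosed
  rw [key y z hy hz]
  apply Order.coheight_anti
  intro w hw
  rw [show w = z from hw]
  exact hzW

theorem CUF_fiber_chart {X S A B : Type} [TopologicalSpace X] [TopologicalSpace S]
    [CommRing A] [CommRing B] [Algebra A B]
    (g : X → S) (φ : PrimeSpectrum B → X) (ψ : PrimeSpectrum A → S)
    (hφ : Topology.IsOpenEmbedding φ) (hψ : Topology.IsOpenEmbedding ψ)
    (comm : ∀ p, g (φ p) = ψ (PrimeSpectrum.comap (algebraMap A B) p))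
    (s : S) (hs : IsClosed ({s} : Set S)) (hirr : IsIrreducible (g ⁻¹' {s}))
    (n : PrimeSpectrum B) (hn : g (φ n) = s) :
    ∃ P : Ideal B, P.IsPrime ∧ (∀ n' : PrimeSpectrum B, P ≤ n'.asIdeal ↔ g (φ n') = s) ∧
      P ≤ ((n.asIdeal.comap (algebraMap A B)).map (algebraMap A B)).radical ∧
      (P.comap (algebraMap A B)).IsMaximal ∧
      ∃ f : PrimeSpectrum (B ⧸ P) → (g ⁻¹' {s} : Set X), Topology.IsOpenEmbedding f ∧
        ∀ z, (f z : X) = φ (PrimeSpectrum.comap (Ideal.Quotient.mk P) z) := by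
  set m := PrimeSpectrum.comap (algebraMap A B) n with hm
  have hsm : ψ m = s := by rw [← comm, hn]
  have hmmax : m.asIdeal.IsMaximal := CUF_chart_max A ψ hψ m (hsm ▸ hs)
  have hmem : ∀ n' : PrimeSpectrum B, g (φ n') = s ↔ PrimeSpectrum.comap (algebraMap A B) n' = m := by
    intro n'
    rw [comm, ← hsm, hψ.injective.eq_iff]
  have hmem2 : φ ⁻¹' (g ⁻¹' {s}) = PrimeSpectrum.zeroLocus (m.asIdeal.map (algebraMap A B) : Set B) := by
    ext n'
    simp only [Set.mem_preimage, Set.mem_singleton_iff]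
    rw [hmem, PrimeSpectrum.mem_zeroLocus, SetLike.coe_subset_coe, Ideal.map_le_iff_le_comap]
    constructor
    · intro h; rw [← h]; exact le_rfl
    · intro h
      ext1
      exact (hmmax.eq_of_le (n'.asIdeal.comap_ne_top _ n'.2.ne_top) h).symm
  have hirr2 : IsIrreducible (φ ⁻¹' (g ⁻¹' {s})) :=
    ⟨⟨n, hn⟩, hirr.2.preimage hφ⟩
  set P := PrimeSpectrum.vanishingIdeal (φ ⁻¹' (g ⁻¹' {s})) with hP
  have hPr : P = (m.asIdeal.map (algebraMap A B)).radical := by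
    rw [hP, hmem2, PrimeSpectrum.vanishingIdeal_zeroLocus_eq_radical]
  have hPp : P.IsPrime := PrimeSpectrum.isIrreducible_iff_vanishingIdeal_isPrime.1 hirr2
  have hiff : ∀ n' : PrimeSpectrum B, P ≤ n'.asIdeal ↔ g (φ n') = s := by
    intro n'
    have : n' ∈ φ ⁻¹' (g ⁻¹' {s}) ↔ g (φ n') = s := Iff.rfl
    rw [← this, hmem2, PrimeSpectrum.mem_zeroLocus, SetLike.coe_subset_coe, hPr,
      n'.2.radical_le_iff]
  refine ⟨P, hPp, hiff, hPr.le, ?_, ?_⟩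
  · have := (hmem ⟨P, hPp⟩).1 ((hiff ⟨P, hPp⟩).1 le_rfl)
    rw [show P.comap (algebraMap A B) = m.asIdeal from congrArg PrimeSpectrum.asIdeal this]
    exact hmmax
  · have hr : ∀ z : PrimeSpectrum (B ⧸ P), φ (PrimeSpectrum.comap (Ideal.Quotient.mk P) z) ∈ g ⁻¹' {s} := by
      intro z
      refine (hiff _).1 ?_
      intro b hb
      change Ideal.Quotient.mk P b ∈ z.asIdeal
      rw [Ideal.Quotient.eq_zero_iff_mem.2 hb]
      exact zero_mem _
    have hce := PrimeSpectrum.isClosedEmbedding_comap_of_surjective _ (Ideal.Quotient.mk P)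
      Ideal.Quotient.mk_surjective
    refine ⟨Set.codRestrict _ _ hr, ⟨(hφ.isEmbedding.comp hce.isEmbedding).codRestrict _ _, ?_⟩, fun _ => rfl⟩
    have : Set.range (Set.codRestrict _ _ hr) = Subtype.val ⁻¹' (Set.range φ) := by
      ext ⟨y, hy⟩
      constructor
      · rintro ⟨z, hz⟩
        exact ⟨_, congrArg Subtype.val hz⟩
      · rintro ⟨p, hp⟩
        have hp' : φ p = y := hp
        subst hp'
        have hPle := (hiff p).2 hy
        have : p ∈ Set.range (PrimeSpectrum.comap (Ideal.Quotient.mk P)) := by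
          rw [range_comap_of_surjective _ _ Ideal.Quotient.mk_surjective, Ideal.mk_ker]
          exact hPle
        obtain ⟨z, rfl⟩ := this
        exact ⟨z, rfl⟩
    rw [this]
    exact hφ.isOpen_range.preimage continuous_subtype_val

/-- A chart at a point for a continuous map, given by finite type algebras. -/
def CUF_HasChart (k : Type) [Field k] {X S : Type} [TopologicalSpace X] [TopologicalSpace S]
    (g : X → S) (x : X) : Prop :=
  ∃ (A B : Type) (_ : CommRing A) (_ : CommRing B) (_ : Algebra k A) (_ : Algebra k B)
    (_ : Algebra A B) (_ : IsScalarTower k A B) (_ : Algebra.FiniteType k A)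
    (_ : Algebra.FiniteType k B) (φ : PrimeSpectrum B → X) (ψ : PrimeSpectrum A → S),
    Topology.IsOpenEmbedding φ ∧ Topology.IsOpenEmbedding ψ ∧
    (∀ p, g (φ p) = ψ (PrimeSpectrum.comap (algebraMap A B) p)) ∧ x ∈ Set.range φ

theorem CUF_fiber_height (k : Type) [Field k] {X S : Type} [TopologicalSpace X]
    [TopologicalSpace S] [JacobsonSpace X] (g : X → S) (hg : Continuous g)
    (charts : ∀ x, CUF_HasChart k g x) (d : ℕ)
    {A B : Type} [CommRing A] [CommRing B] [Algebra A B]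
    (φ : PrimeSpectrum B → X) (ψ : PrimeSpectrum A → S)
    (hφ : Topology.IsOpenEmbedding φ) (hψ : Topology.IsOpenEmbedding ψ)
    (comm : ∀ p, g (φ p) = ψ (PrimeSpectrum.comap (algebraMap A B) p))
    (s : S) (hs : IsClosed ({s} : Set S)) (hirr : IsIrreducible (g ⁻¹' {s}))
    (hd : topologicalKrullDim (g ⁻¹' {s} : Set X) = d)
    (n : PrimeSpectrum B) (hn : g (φ n) = s) (hx : IsClosed {φ n}) :
    ∃ P : Ideal B, P.IsPrime ∧ (∀ n' : PrimeSpectrum B, P ≤ n'.asIdeal ↔ g (φ n') = s) ∧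
      P ≤ ((n.asIdeal.comap (algebraMap A B)).map (algebraMap A B)).radical ∧
      (P.comap (algebraMap A B)).IsMaximal ∧
      (n.asIdeal.map (Ideal.Quotient.mk P)).height = d := by
  obtain ⟨P, hP, h1, h2, h3, f, hf, hfφ⟩ := CUF_fiber_chart g φ ψ hφ hψ comm s hs hirr n hn
  refine ⟨P, hP, h1, h2, h3, ?_⟩
  have hcl : IsClosed (g ⁻¹' {s}) := hs.preimage hg
  have : JacobsonSpace (g ⁻¹' {s} : Set X) := .of_isClosedEmbedding hcl.isClosedEmbedding_subtypeVal
  have : IrreducibleSpace (g ⁻¹' {s} : Set X) := by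
    have := Set.nonempty_coe_sort.2 hirr.1
    have := Subtype.preirreducibleSpace hirr.2
    constructor
    assumption
  have hz : ∃ z, PrimeSpectrum.comap (Ideal.Quotient.mk P) z = n := by
    change n ∈ Set.range (PrimeSpectrum.comap (Ideal.Quotient.mk P))
    rw [range_comap_of_surjective _ _ Ideal.Quotient.mk_surjective, Ideal.mk_ker]
    exact (h1 n).2 hn
  obtain ⟨z, rfl⟩ := hz
  have hy : IsClosed {f z} := by
    have := hx.preimage (continuous_subtype_val (p := fun x => x ∈ g ⁻¹' {s}))
    convert this
    ext y
    simp only [Set.mem_singleton_iff, Set.mem_preimage, ← hfφ, Subtype.ext_iff]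
  have := CUF_dim k d hd ?_ (f z) hy
  · rw [CUF_chart_coheight _ f hf] at this
    rw [← this]
    congr 1
    exact Ideal.map_comap_of_surjective _ Ideal.Quotient.mk_surjective _
  · intro y _
    obtain ⟨A', B', _, _, _, _, _, _, _, _, φ', ψ', hφ', hψ', comm', p, hp⟩ := charts y.1
    obtain ⟨P', hP', h1', -, -, f', hf', hfφ'⟩ := CUF_fiber_chart g φ' ψ' hφ' hψ' comm' s hs hirr p
      (by rw [hp]; exact y.2)
    refine ⟨B' ⧸ P', inferInstance, inferInstance, inferInstance, inferInstance, f', hf', ?_⟩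
    have hz : p ∈ Set.range (PrimeSpectrum.comap (Ideal.Quotient.mk P')) := by
      rw [range_comap_of_surjective _ _ Ideal.Quotient.mk_surjective, Ideal.mk_ker]
      exact (h1' p).2 (by rw [hp]; exact y.2)
    obtain ⟨z', rfl⟩ := hz
    exact ⟨z', Subtype.ext (by rw [hfφ', hp])⟩

theorem CUF_closed_map (k : Type) [Field k] {X S : Type} [TopologicalSpace X]
    [TopologicalSpace S] [JacobsonSpace S] (g : X → S)
    (charts : ∀ x, CUF_HasChart k g x) (x : X) (hx : IsClosed {x}) : IsClosed {g x} := by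
  obtain ⟨A, B, _, _, _, _, _, _, _, _, φ, ψ, hφ, hψ, comm, p, rfl⟩ := charts x
  have := CUF_chart_max B φ hφ p hx
  have := CUF_comap_max k A B p.asIdeal
  have hc : IsClosed {PrimeSpectrum.comap (algebraMap A B) p} :=
    (PrimeSpectrum.isClosed_singleton_iff_isMaximal _).2 this
  apply isClosed_singleton_of_isLocallyClosed_singleton
  rw [comm, ← Set.image_singleton]
  exact hc.isLocallyClosed.image hψ.isInducing hψ.isOpen_range.isLocallyClosed

theorem CUF_claim1 (k : Type) [Field k] {X S : Type} [TopologicalSpace X]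
    [TopologicalSpace S] [JacobsonSpace X] [JacobsonSpace S] [NoetherianSpace X]
    (g : X → S) (hg : Continuous g)
    (charts : ∀ x, CUF_HasChart k g x) (d : ℕ)
    (hfib : ∀ s : S, IsClosed ({s} : Set S) →
      IsIrreducible (g ⁻¹' {s}) ∧ topologicalKrullDim (g ⁻¹' {s} : Set X) = d)
    (C : Set X) (hC : C ∈ irreducibleComponents X) (s : S) (hs : IsClosed ({s} : Set S))
    (hne : (C ∩ g ⁻¹' {s}).Nonempty) : g ⁻¹' {s} ⊆ C := by
  have hCc : IsClosed C := isClosed_of_mem_irreducibleComponents C hC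
  have hCi : IsIrreducible C := hC.1
  obtain ⟨x, ⟨hxC, hxs⟩, hx⟩ := nonempty_inter_closedPoints hne
    (hCc.inter (hs.preimage hg)).isLocallyClosed
  obtain ⟨A, B, _, _, _, _, _, _, _, _, φ, ψ, hφ, hψ, comm, n, rfl⟩ := charts x
  have hx : IsClosed {φ n} := hx
  have hirr2 : IsIrreducible (φ ⁻¹' C) := ⟨⟨n, hxC⟩, hCi.2.preimage hφ⟩
  have hCc2 : IsClosed (φ ⁻¹' C) := hCc.preimage hφ.continuous
  set q := PrimeSpectrum.vanishingIdeal (φ ⁻¹' C) with hq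
  have hqp : q.IsPrime := PrimeSpectrum.isIrreducible_iff_vanishingIdeal_isPrime.1 hirr2
  have hqC : ∀ p : PrimeSpectrum B, q ≤ p.asIdeal ↔ φ p ∈ C := by
    intro p
    have : p ∈ PrimeSpectrum.zeroLocus (q : Set B) ↔ p ∈ φ ⁻¹' C := by
      rw [hq, PrimeSpectrum.zeroLocus_vanishingIdeal_eq_closure, hCc2.closure_eq]
    exact this
  obtain ⟨e, ⟨c, hcq, ha⟩, hb⟩ := CUF_master k A B q
  -- the good point
  have hfin : (irreducibleComponents X).Finite := NoetherianSpace.finite_irreducibleComponents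
  set O : Set X := ⋃₀ (irreducibleComponents X \ {C}) with hO
  have hOc : IsClosed O := hO ▸ Set.sUnion_eq_biUnion ▸ (hfin.subset Set.sdiff_subset).isClosed_biUnion
    (fun D hD => isClosed_of_mem_irreducibleComponents D hD.1)
  have hCO : ¬ C ⊆ O := by
    intro h
    obtain ⟨D, hD, hCD⟩ := (isIrreducible_iff_sUnion_isClosed.1 hCi)
      (hfin.subset Set.sdiff_subset).toFinset
      (fun D hD => isClosed_of_mem_irreducibleComponents D (by simpa using (Set.Finite.mem_toFinset _ |>.1 hD).1))
      (by simpa using h)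
    have hD' := (Set.Finite.mem_toFinset _).1 hD
    exact hD'.2 (Set.Subset.antisymm (hC.2 hD'.1.1 hCD) hCD)
  have hUo : IsOpen (φ '' (PrimeSpectrum.basicOpen c)) := hφ.isOpenMap _ (PrimeSpectrum.basicOpen c).2
  have hne2 : (C ∩ (φ '' (PrimeSpectrum.basicOpen c) ∩ Oᶜ)).Nonempty := by
    refine hCi.2 _ _ hUo hOc.isOpen_compl ?_ ?_
    · exact ⟨φ ⟨q, hqp⟩, (hqC ⟨q, hqp⟩).1 le_rfl, ⟨q, hqp⟩, hcq, rfl⟩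
    · obtain ⟨y, hy, hy'⟩ := Set.not_subset.1 hCO
      exact ⟨y, hy, hy'⟩
  obtain ⟨x', ⟨hx'C, ⟨n', hn'c, rfl⟩, hx'O⟩, hx'⟩ := nonempty_inter_closedPoints hne2
    (hCc.isLocallyClosed.inter (hUo.inter hOc.isOpen_compl).isLocallyClosed)
  have hx' : IsClosed {φ n'} := hx'
  have hs' := CUF_closed_map k g charts _ hx'
  obtain ⟨hi', hd'⟩ := hfib _ hs'
  have hsub : g ⁻¹' {g (φ n')} ⊆ C := by
    obtain ⟨D, hD, hDs⟩ := exists_mem_irreducibleComponents_subset_of_isIrreducible _ hi'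
    by_cases hDC : D = C
    · exact hDC ▸ hDs
    · exact absurd ⟨D, ⟨hD, hDC⟩, hDs rfl⟩ hx'O
  obtain ⟨P', hP'p, hP'1, -, hP'2, hP'h⟩ := CUF_fiber_height k g hg charts d φ ψ hφ hψ comm _ hs'
    hi' hd' n' rfl hx'
  have hde : (d : ℕ∞) ≤ e := by
    rw [← hP'h]
    exact ha n'.asIdeal P' (CUF_chart_max B φ hφ n' hx') hn'c hP'p ((hP'1 n').2 rfl)
      ((hqC ⟨P', hP'p⟩).2 (hsub ((hP'1 ⟨P', hP'p⟩).1 le_rfl))) hP'2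
  obtain ⟨hi, hd⟩ := hfib _ hs
  obtain ⟨P, hPp, hP1, hP2, -, hPh⟩ := CUF_fiber_height k g hg charts d φ ψ hφ hψ comm _ hs
    hi hd n hxs hx
  have hqP : q ≤ P := by
    by_contra hcon
    have := hb n.asIdeal P (CUF_chart_max B φ hφ n hx) ((hqC n).2 hxC) hPp ((hP1 n).2 hxs) hP2 hcon
    rw [hPh] at this
    have := this.trans hde
    norm_cast at this
    omega
  have hsub2 : g ⁻¹' {s} ∩ Set.range φ ⊆ C := by
    rintro _ ⟨hy, p, rfl⟩
    exact (hqC p).1 (hqP.trans ((hP1 p).2 hy))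
  intro y hy
  by_contra hyC
  obtain ⟨z, hz, hz1, hz2⟩ := hi.2 _ _ hφ.isOpen_range hCc.isOpen_compl ⟨_, hxs, ⟨n, rfl⟩⟩ ⟨y, hy, hyC⟩
  exact hz2 (hsub2 ⟨hz, hz1⟩)

theorem CUF_constr {X : Type} [TopologicalSpace X] [JacobsonSpace X] (s : Set X)
    (hs : Topology.IsConstructible s) (h : ∀ x ∈ s, ¬ IsClosed {x}) : s = ∅ := by
  have hs' : s ∈ BooleanSubalgebra.closure {U : Set X | IsOpen U} :=
    BooleanSubalgebra.closure_mono (fun U hU => hU.1) hs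
  have hsub : IsSublattice {U : Set X | IsOpen U} :=
    ⟨fun _ ha _ hb => IsOpen.union ha hb, fun _ ha _ hb => IsOpen.inter ha hb⟩
  obtain ⟨t, rfl⟩ := (BooleanSubalgebra.mem_closure_iff_sup_sdiff hsub isOpen_empty isOpen_univ).mp hs'
  by_contra hne
  obtain ⟨x, hx⟩ := Set.nonempty_iff_ne_empty.2 hne
  rw [Finset.sup_eq_iSup] at hx h
  simp only [Set.iSup_eq_iUnion, Set.mem_iUnion] at hx h
  obtain ⟨u, hu, hx⟩ := hx
  have hlc : IsLocallyClosed (u.1.1 \ u.2.1) := by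
    have h1 : IsOpen u.1.1 := u.1.2
    have h2 : IsOpen u.2.1 := u.2.2
    exact h1.isLocallyClosed.inter h2.isClosed_compl.isLocallyClosed
  obtain ⟨y, hy, hy'⟩ := nonempty_inter_closedPoints ⟨x, hx⟩ hlc
  exact h y ⟨u, hu, hy⟩ hy'

theorem CUF_chart_exists (k : Type) [Field k] (X S : Scheme)
    (aX : X ⟶ Spec (CommRingCat.of k)) (aS : S ⟶ Spec (CommRingCat.of k))
    [LocallyOfFiniteType aX] [LocallyOfFiniteType aS]
    (g : X ⟶ S) (hg : g ≫ aS = aX) (x : X) : CUF_HasChart k (fun x : X => g x) x := by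
  subst hg
  obtain ⟨V, hV, hxV, -⟩ := exists_isAffineOpen_mem_and_subset (x := g x) (U := (⊤ : S.Opens)) trivial
  obtain ⟨U, hU, hxU, hUV⟩ := exists_isAffineOpen_mem_and_subset (x := x) (U := g ⁻¹ᵁ V) hxV
  have hUV : U ≤ g ⁻¹ᵁ V := hUV
  let i := (Scheme.ΓSpecIso (CommRingCat.of k)).inv
  have hi : i.hom.FiniteType :=
    RingHom.FiniteType.of_surjective _ (ConcreteCategory.bijective_of_isIso i).2
  let fS := aS.appLE ⊤ V le_top
  let fX := (g ≫ aS).appLE ⊤ U le_top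
  have hfS : fS.hom.FiniteType := aS.finiteType_appLE (isAffineOpen_top _) hV _
  have hfX : fX.hom.FiniteType := (g ≫ aS).finiteType_appLE (isAffineOpen_top _) hU _
  let f := g.appLE V U hUV
  have hc : (i ≫ fS) ≫ f = i ≫ fX := by
    rw [Category.assoc]
    exact congrArg (fun h => i ≫ h) (Scheme.Hom.appLE_comp_appLE g aS ⊤ V U _ _)
  let : Algebra k Γ(S, V) := (i ≫ fS).hom.toAlgebra
  let : Algebra k Γ(X, U) := (i ≫ fX).hom.toAlgebra
  let : Algebra Γ(S, V) Γ(X, U) := f.hom.toAlgebra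
  refine ⟨Γ(S, V), Γ(X, U), inferInstance, inferInstance, inferInstance, inferInstance,
    inferInstance, ?_, ?_, ?_, fun p => hU.fromSpec p, fun p => hV.fromSpec p, ?_, ?_, ?_, ?_⟩
  · refine IsScalarTower.of_algebraMap_eq' ?_
    change (i ≫ fX).hom = f.hom.comp (i ≫ fS).hom
    rw [← hc]; rfl
  · exact hfS.comp hi
  · exact hfX.comp hi
  · exact hU.fromSpec.isOpenEmbedding
  · exact hV.fromSpec.isOpenEmbedding
  · intro p
    have := IsAffineOpen.SpecMap_appLE_fromSpec g hV hU hUV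
    have := congrArg (fun h => h.base p) this
    exact this.symm
  · change x ∈ Set.range hU.fromSpec
    rw [hU.range_fromSpec]
    exact hxU

theorem CUF_main
    (k : Type) [Field k] 
    (X S : Scheme)
    (aX : X ⟶ Spec (CommRingCat.of k)) (aS : S ⟶ Spec (CommRingCat.of k))
    [LocallyOfFiniteType aX] [QuasiCompact aX]
    [LocallyOfFiniteType aS] [QuasiCompact aS] 
    (g : X ⟶ S) (hg : g ≫ aS = aX)
    (d : ℕ)
    (hfib : ∀ s : S, IsClosed ({s} : Set S) →
      IsIrreducible (g ⁻¹' {s}) ∧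
      topologicalKrullDim (g ⁻¹' {s}) = d) :
    (∀ C ∈ irreducibleComponents X, ∀ x ∈ C, g ⁻¹' {g x} ⊆ C) ∧
    (∀ T ∈ irreducibleComponents S,
      ∃! C, C ∈ irreducibleComponents X ∧ closure (g '' C) = T) := by
  have charts := CUF_chart_exists k X S aX aS g hg
  have : JacobsonSpace X := LocallyOfFiniteType.jacobsonSpace aX
  have : JacobsonSpace S := LocallyOfFiniteType.jacobsonSpace aS
  have : IsLocallyNoetherian X := LocallyOfFiniteType.isLocallyNoetherian aX
  have : IsLocallyNoetherian S := LocallyOfFiniteType.isLocallyNoetherian aS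
  have : CompactSpace X := QuasiCompact.compactSpace_of_compactSpace aX
  have : CompactSpace S := QuasiCompact.compactSpace_of_compactSpace aS
  have : IsNoetherian X := {}
  have : IsNoetherian S := {}
  have : LocallyOfFiniteType (g ≫ aS) := hg ▸ inferInstance
  have : LocallyOfFiniteType g := locallyOfFiniteType_of_comp g aS
  have hcp := CUF_closed_map k (fun x : X => g x) charts
  have claim1 := CUF_claim1 k (fun x : X => g x) g.continuous charts d hfib
  have hcc : ∀ C : Set X, IsClosed C → Topology.IsConstructible C := fun C hC =>
    ((NoetherianSpace.isCompact Cᶜ).isConstructible hC.isOpen_compl).of_compl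
  have part1 : ∀ C ∈ irreducibleComponents X, ∀ x ∈ C, g ⁻¹' {g x} ⊆ C := by
    intro C hC x hx y hy
    by_contra hyC
    have hCcl := isClosed_of_mem_irreducibleComponents C hC
    have hE : Topology.IsConstructible ((g ⁻¹' (g '' C)) \ C) :=
      (g.isConstructible_preimage (g.isConstructible_image (hcc C hCcl))).sdiff (hcc C hCcl)
    have := CUF_constr _ hE (by
      rintro z ⟨⟨w, hw, hwz⟩, hzC⟩ hz
      exact hzC (claim1 C hC (g z) (hcp z hz) ⟨w, hw, hwz⟩ rfl))
    have hy2 : y ∈ (g ⁻¹' (g '' C)) \ C := ⟨⟨x, hx, (show g y = g x from hy).symm⟩, hyC⟩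
    rw [this] at hy2
    exact hy2
  have hsurj : ∀ s : S, ∃ x : X, g x = s := by
    intro s
    by_contra hs
    have hE : Topology.IsConstructible (g '' Set.univ)ᶜ :=
      (g.isConstructible_image (hcc _ isClosed_univ)).compl
    have := CUF_constr _ hE (by
      intro t ht htc
      obtain ⟨x, hx⟩ := (hfib t htc).1.1
      exact ht ⟨x, trivial, hx⟩)
    have hs2 : s ∈ (g '' Set.univ)ᶜ := by
      rintro ⟨x, -, hx⟩
      exact hs ⟨x, hx⟩
    rw [this] at hs2
    exact hs2
  refine ⟨part1, fun T hT => ?_⟩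
  have hTc := isClosed_of_mem_irreducibleComponents T hT
  obtain ⟨η, hη⟩ := QuasiSober.sober hT.1 hTc
  have hη : closure {η} = T := hη
  have hgen : ∀ C ∈ irreducibleComponents X, closure (g '' C) = T →
      ∃ c, closure {c} = C ∧ g c = η := by
    intro C hC hCT
    obtain ⟨c, hc⟩ := QuasiSober.sober hC.1 (isClosed_of_mem_irreducibleComponents C hC)
    have hc : closure {c} = C := hc
    refine ⟨c, hc, ?_⟩
    have h2 : closure {g c} = closure {η} := by
      rw [hη, ← hCT, ← hc, closure_image_closure g.continuous, Set.image_singleton]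
    have h3 : Inseparable (g c) η := by
      rw [inseparable_iff_closure_eq]; exact h2
    exact h3.eq
  obtain ⟨y, hy⟩ := hsurj η
  refine ⟨irreducibleComponent y, ⟨irreducibleComponent_mem_irreducibleComponents y, ?_⟩, ?_⟩
  · have h1 : IsIrreducible (closure (g '' irreducibleComponent y)) :=
      (isIrreducible_irreducibleComponent.image _ g.continuous.continuousOn).closure
    have h2 : T ⊆ closure (g '' irreducibleComponent y) := by
      rw [← hη]
      apply closure_mono
      rintro _ rfl
      exact ⟨y, mem_irreducibleComponent, hy⟩
    exact Set.Subset.antisymm (hT.2 h1 h2) h2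
  · rintro C ⟨hC, hCT⟩
    obtain ⟨c, hc, hcη⟩ := hgen C hC hCT
    have hcC : c ∈ C := hc ▸ subset_closure rfl
    have hyC := irreducibleComponent_mem_irreducibleComponents y
    have h1 : c ∈ irreducibleComponent y :=
      part1 _ hyC y mem_irreducibleComponent (show g c = g y by rw [hcη, hy])
    have h2 : C ⊆ irreducibleComponent y := by
      rw [← hc]
      exact closure_minimal (by rintro _ rfl; exact h1) isClosed_irreducibleComponent
    exact Set.Subset.antisymm h2 (hC.2 hyC.1 h2)

end CUF_sec2

/-- Proposition 2.1 of the paper, first part. Let `g : X → S` be a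
morphism of algebraic varieties (reduced separated schemes of finite type) over an
algebraically closed field `k` such that every fiber of `g` over a closed point is
irreducible of dimension `d ≥ 1`. Then every irreducible component of `X` is a union of
fibers of `g`, and every irreducible component of `S` is dominated by a unique
irreducible component of `X`. -/
theorem components_union_of_fibers
    (k : Type) [Field k] [IsAlgClosed k]
    (X S : Scheme) [IsReduced X] [IsReduced S]
    (aX : X ⟶ Spec (CommRingCat.of k)) (aS : S ⟶ Spec (CommRingCat.of k))
    [LocallyOfFiniteType aX] [QuasiCompact aX] [IsSeparated aX]
    [LocallyOfFiniteType aS] [QuasiCompact aS] [IsSeparated aS]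
    (g : X ⟶ S) (hg : g ≫ aS = aX)
    (d : ℕ) (hd : 1 ≤ d)
    (hfib : ∀ s : S, IsClosed ({s} : Set S) →
      IsIrreducible (g.base ⁻¹' {s}) ∧
      topologicalKrullDim (g.base ⁻¹' {s}) = d) :
    (∀ C ∈ irreducibleComponents X, ∀ x ∈ C, g.base ⁻¹' {g.base x} ⊆ C) ∧
    (∀ T ∈ irreducibleComponents S,
      ∃! C, C ∈ irreducibleComponents X ∧ closure (g.base '' C) = T) := by
  exact CUF_main k X S aX aS g hg d hfib
end
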